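/- arXiv:1704.02143 — 5 statements merged into one kernel-verified Lean document; each statement's English description precedes it below -/
import Mathlib

section
/- For ν > -1 and α, β > 0, the Laplace transform of the Bessel function J_ν satisfies ∫₀^∞ e^{-αx} J_ν(βx) dx = (√(α²+β²) − α)^ν / (β^ν √(α²+β²)). -/
open MeasureTheory Real

/-- Bessel function of the first kind of order `ν`, defined for `x ≥ 0` by its power series
`J_ν(x) = Σ_{m≥0} (−1)^m/(m! Γ(m+ν+1)) (x/2)^{2m+ν}`. -/
noncomputable def besselJ (ν x : ℝ) : ℝ :=
  ∑' m : ℕ, (-1 : ℝ) ^ m / (m.factorial * Real.Gamma (m + ν + 1)) * (x / 2) ^ (2 * (m : ℝ) + ν)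


noncomputable def bphi (ν t : ℝ) : ℝ :=
  ∑' m : ℕ, (-t) ^ m / (m.factorial * Real.Gamma (m + ν + 1))

lemma bgamma_mono (ν : ℝ) (hν : 0 ≤ ν) (m : ℕ) : Real.Gamma (ν + 1) ≤ Real.Gamma (m + ν + 1) := by
  induction m with
  | zero => simp
  | succ n ih =>
    have h : ((n + 1 : ℕ) : ℝ) + ν + 1 = (n + ν + 1) + 1 := by push_cast; ring
    have hp : (0:ℝ) < n + ν + 1 := by positivity
    rw [h, Real.Gamma_add_one hp.ne']
    have := Real.Gamma_pos_of_pos hp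
    have h1 : (1:ℝ) ≤ n + ν + 1 := by have : (0:ℝ) ≤ n := by positivity
                                      linarith
    nlinarith

lemma bgamma_pos (ν : ℝ) (hν : -1 < ν) (m : ℕ) : 0 < Real.Gamma (m + ν + 1) := by
  apply Real.Gamma_pos_of_pos
  have : (0:ℝ) ≤ m := by positivity
  linarith

lemma binv_gamma_bound (ν : ℝ) (hν : -1 < ν) :
    ∃ C : ℝ, ∀ m : ℕ, (Real.Gamma (m + ν + 1))⁻¹ ≤ C := by
  refine ⟨max (Real.Gamma (ν + 1))⁻¹ (Real.Gamma (ν + 1 + 1))⁻¹, fun m => ?_⟩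
  cases m with
  | zero => simp
  | succ n =>
    apply le_max_of_le_right
    have h := bgamma_mono (ν + 1) (by linarith) n
    have h2 : ((n + 1 : ℕ) : ℝ) + ν + 1 = n + (ν + 1) + 1 := by push_cast; ring
    rw [h2]
    have : 0 < Real.Gamma (ν + 1 + 1) := Real.Gamma_pos_of_pos (by linarith)
    gcongr

lemma bphi_summable (ν : ℝ) (hν : -1 < ν) (t : ℝ) :
    Summable (fun m : ℕ => (-t) ^ m / (m.factorial * Real.Gamma (m + ν + 1))) := by
  obtain ⟨C, hC⟩ := binv_gamma_bound ν hν
  refine Summable.of_norm_bounded (g := fun m : ℕ => |t| ^ m / m.factorial * C)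
    ((Real.summable_pow_div_factorial |t|).mul_right C) fun m => ?_
  have hg := bgamma_pos ν hν m
  rw [norm_div, norm_pow, norm_neg, norm_mul, Real.norm_of_nonneg hg.le, Real.norm_natCast,
    Real.norm_eq_abs, ← div_div, div_eq_mul_inv (_ / _)]
  gcongr
  exact hC m

lemma bphi_hasDerivAt (ν : ℝ) (hν : -1 < ν) (t : ℝ) :
    HasDerivAt (bphi ν) (-bphi (ν + 1) t) t := by
  obtain ⟨C, hC⟩ := binv_gamma_bound (ν + 1) (by linarith)
  set R := |t| + 1 with hR
  have key : ∀ (m : ℕ) (y : ℝ), ((m + 1 : ℕ) : ℝ) * (-y) ^ m * (-1) /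
      ((m + 1).factorial * Real.Gamma ((m + 1 : ℕ) + ν + 1))
      = -((-y) ^ m / (m.factorial * Real.Gamma (m + (ν + 1) + 1))) := by
    intro m y
    have h2 : ((m + 1 : ℕ) : ℝ) + ν + 1 = m + (ν + 1) + 1 := by push_cast; ring
    rw [h2, Nat.factorial_succ]
    have := bgamma_pos (ν + 1) (by linarith) m
    push_cast
    field_simp
  have hu : Summable (fun m : ℕ => (if m = 0 then 0 else R ^ (m - 1) / (m - 1).factorial * C)) := by
    rw [← summable_nat_add_iff 1]
    simpa using (Real.summable_pow_div_factorial R).mul_right C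
  have h := hasDerivAt_tsum_of_isPreconnected (𝕜 := ℝ)
    (g := fun (m : ℕ) (y : ℝ) => (-y) ^ m / (m.factorial * Real.Gamma (m + ν + 1)))
    (g' := fun (m : ℕ) (y : ℝ) => (m : ℝ) * (-y) ^ (m - 1) * (-1) /
      (m.factorial * Real.Gamma (m + ν + 1)))
    (t := Metric.ball 0 R) (y₀ := t) (y := t) hu Metric.isOpen_ball
    (convex_ball _ _).isPreconnected ?_ ?_ ?_ (bphi_summable ν hν t) ?_
  · have hs : Summable (fun m : ℕ => (m : ℝ) * (-t) ^ (m - 1) * (-1) /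
      (m.factorial * Real.Gamma (m + ν + 1))) := by
      rw [← summable_nat_add_iff 1]
      simp only [Nat.add_sub_cancel, key]
      exact (bphi_summable (ν + 1) (by linarith) t).neg
    rw [hs.tsum_eq_zero_add] at h
    simp only [Nat.add_sub_cancel, key, tsum_neg] at h
    simpa [bphi] using! h
  · intro m y _
    have h1 : HasDerivAt (fun y : ℝ => (-y) ^ m) ((m : ℝ) * (-y) ^ (m - 1) * (-1)) y :=
      (hasDerivAt_neg y).pow m
    exact h1.div_const _
  · intro m y hy
    cases m with
    | zero => simp
    | succ n =>
      simp only [Nat.add_sub_cancel, key, Nat.succ_ne_zero, if_false]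
      have hg := bgamma_pos (ν + 1) (by linarith) n
      rw [norm_neg, norm_div, norm_pow, norm_neg, norm_mul, Real.norm_of_nonneg hg.le,
        Real.norm_natCast, ← div_div, div_eq_mul_inv (_ / _)]
      have hy' : ‖y‖ ≤ R := by simpa using (mem_ball_zero_iff.mp hy).le
      gcongr
      exact hC n
  · simp [hR]
  · simp [hR]

lemma bphi_rec (ν : ℝ) (hν : -1 < ν) (t : ℝ) :
    bphi ν t = (ν + 1) * bphi (ν + 1) t - t * bphi (ν + 2) t := by
  have s0 := bphi_summable ν hν t
  have s1 := bphi_summable (ν + 1) (by linarith) t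
  have s2 := bphi_summable (ν + 2) (by linarith) t
  unfold bphi
  rw [s0.tsum_eq_zero_add, s1.tsum_eq_zero_add, mul_add, ← tsum_mul_left, ← tsum_mul_left,
    add_sub_assoc, ← Summable.tsum_sub]
  · congr 1
    · have : 0 < Real.Gamma (ν + 1) := Real.Gamma_pos_of_pos (by linarith)
      have h1 : ν + 1 ≠ 0 := by linarith
      simp only [pow_zero, Nat.factorial_zero, Nat.cast_one, Nat.cast_zero, zero_add, one_mul]
      rw [Real.Gamma_add_one h1]
      field_simp
    · congr 1
      ext m
      have hm : (0:ℝ) ≤ m := by positivity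
      have a1 : ((m + 1 : ℕ) : ℝ) + ν + 1 = m + ν + 2 := by push_cast; ring
      have a2 : ((m + 1 : ℕ) : ℝ) + (ν + 1) + 1 = (m + ν + 2) + 1 := by push_cast; ring
      have a3 : (m : ℝ) + (ν + 2) + 1 = (m + ν + 2) + 1 := by ring
      have hp : 0 < (m : ℝ) + ν + 2 := by linarith
      have := Real.Gamma_pos_of_pos hp
      rw [a1, a2, a3, Real.Gamma_add_one hp.ne', Nat.factorial_succ, pow_succ]
      push_cast
      field_simp
      ring
  · exact ((summable_nat_add_iff 1).mpr s1).mul_left _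
  · exact s2.mul_left _

lemma bphi_zero (ν : ℝ) : bphi ν 0 = (Real.Gamma (ν + 1))⁻¹ := by
  unfold bphi
  rw [tsum_eq_single 0]
  · simp
  · intro m hm
    simp [hm]

lemma bphi_bound_nonneg (ν : ℝ) (hν : 0 ≤ ν) (t : ℝ) (ht : 0 ≤ t) :
    |bphi ν t| ≤ (Real.Gamma (ν + 1))⁻¹ := by
  have hd : ∀ x, HasDerivAt (fun t => bphi ν t ^ 2 + t * bphi (ν + 1) t ^ 2)
      (-(2 * ν + 1) * bphi (ν + 1) x ^ 2) x := by
    intro x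
    have h0 := bphi_hasDerivAt ν (by linarith) x
    have h1 := bphi_hasDerivAt (ν + 1) (by linarith) x
    have hr := bphi_rec ν (by linarith) x
    rw [show ν + 1 + 1 = ν + 2 by ring] at h1
    refine ((h0.pow 2).add ((hasDerivAt_id x).mul (h1.pow 2))).congr_deriv ?_
    simp only [id, Pi.pow_apply]
    push_cast
    linear_combination (-2 * bphi (ν + 1) x) * hr
  have ha : AntitoneOn (fun t => bphi ν t ^ 2 + t * bphi (ν + 1) t ^ 2) Set.univ := by
    apply antitoneOn_of_deriv_nonpos convex_univ
    · exact fun x _ => (hd x).continuousAt.continuousWithinAt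
    · exact fun x _ => (hd x).differentiableAt.differentiableWithinAt
    · intro x _
      rw [(hd x).deriv]
      nlinarith [sq_nonneg (bphi (ν + 1) x)]
  have h := ha (Set.mem_univ 0) (Set.mem_univ t) ht
  simp only [zero_mul, add_zero, bphi_zero] at h
  have hg : 0 < Real.Gamma (ν + 1) := Real.Gamma_pos_of_pos (by linarith)
  apply abs_le_of_sq_le_sq _ (by positivity)
  nlinarith [mul_nonneg ht (sq_nonneg (bphi (ν + 1) t))]

lemma bphi_bound (ν : ℝ) (hν : -1 < ν) :
    ∃ C : ℝ, 0 ≤ C ∧ ∀ t : ℝ, 0 ≤ t → |bphi ν t| ≤ C * (1 + t) := by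
  have g1 : 0 < Real.Gamma (ν + 1 + 1) := Real.Gamma_pos_of_pos (by linarith)
  have g2 : 0 < Real.Gamma (ν + 2 + 1) := Real.Gamma_pos_of_pos (by linarith)
  have hn : 0 < ν + 1 := by linarith
  refine ⟨(ν + 1) * (Real.Gamma (ν + 1 + 1))⁻¹ + (Real.Gamma (ν + 2 + 1))⁻¹, by positivity,
    fun t ht => ?_⟩
  rw [bphi_rec ν hν t]
  have b1 := bphi_bound_nonneg (ν + 1) (by linarith) t ht
  have b2 := bphi_bound_nonneg (ν + 2) (by linarith) t ht
  calc |(ν + 1) * bphi (ν + 1) t - t * bphi (ν + 2) t|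
      ≤ |(ν + 1) * bphi (ν + 1) t| + |t * bphi (ν + 2) t| := abs_sub _ _
    _ = (ν + 1) * |bphi (ν + 1) t| + t * |bphi (ν + 2) t| := by
        rw [abs_mul, abs_mul, abs_of_pos hn, abs_of_nonneg ht]
    _ ≤ (ν + 1) * (Real.Gamma (ν + 1 + 1))⁻¹ + t * (Real.Gamma (ν + 2 + 1))⁻¹ := by gcongr
    _ ≤ _ := by
        have : 0 ≤ (ν + 1) * (Real.Gamma (ν + 1 + 1))⁻¹ := by positivity
        have : 0 ≤ (Real.Gamma (ν + 2 + 1))⁻¹ := by positivity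
        nlinarith

lemma besselJ_eq_bphi (ν x : ℝ) (hx : 0 < x) :
    besselJ ν x = (x / 2) ^ ν * bphi ν (x ^ 2 / 4) := by
  unfold besselJ bphi
  rw [← tsum_mul_left]
  congr 1
  ext m
  have h2 : 0 < x / 2 := by positivity
  rw [Real.rpow_add h2, mul_comm (2:ℝ) m, Real.rpow_mul h2.le, Real.rpow_natCast,
    show ((x/2)^m)^(2:ℝ) = (x^2/4)^m by
      rw [show (2:ℝ) = (2:ℕ) by norm_num, Real.rpow_natCast, ← pow_mul, mul_comm, pow_mul]
      congr 1; push_cast; ring, neg_pow (x^2/4)]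
  ring

lemma bmem_slit {z : ℂ} (hz : z ∈ Metric.closedBall (0:ℂ) (1/2)) : 1 + z ∈ Complex.slitPlane := by
  apply Complex.mem_slitPlane_of_norm_lt_one
  have := mem_closedBall_zero_iff.mp hz
  linarith

lemma bdiffOn (a : ℂ) : DifferentiableOn ℂ (fun z : ℂ => (1 + z) ^ a) (Metric.closedBall 0 (1/2)) := by
  intro z hz
  apply DifferentiableAt.differentiableWithinAt
  exact (DifferentiableAt.cpow (by fun_prop) (by fun_prop) (bmem_slit hz))

lemma bcauchy (a : ℂ) (n : ℕ) :
    (2 * π * Complex.I : ℂ)⁻¹ • ∮ z in C(0, 1/2), (1 / z) ^ n • z⁻¹ • (1 + z) ^ a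
      = Ring.choose a n := by
  have h1 := (DifferentiableOn.hasFPowerSeriesOnBall (R := (1/2 : NNReal)) (c := 0)
    (f := fun z : ℂ => (1 + z) ^ a) (by simpa using bdiffOn a) (by norm_num)).hasFPowerSeriesAt
  have h2 := Complex.one_add_cpow_hasFPowerSeriesAt_zero (a := a)
  have h3 := h1.eq_formalMultilinearSeries h2
  have h4 := congrArg (fun p => p n (fun _ => (1:ℂ))) h3
  simp only [cauchyPowerSeries_apply, binomialSeries_apply] at h4
  simpa using h4

lemma bgamma_asc (x : ℝ) (hx : 0 < x) (n : ℕ) :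
    (ascPochhammer ℝ n).eval x * Real.Gamma x = Real.Gamma (x + n) := by
  induction n with
  | zero => simp
  | succ n ih =>
    rw [ascPochhammer_succ_right]
    simp only [Polynomial.eval_mul, Polynomial.eval_add, Polynomial.eval_X, Polynomial.eval_natCast]
    have hp : 0 < x + n := by positivity
    push_cast
    rw [← add_assoc, Real.Gamma_add_one hp.ne', ← ih]
    ring

lemma bchoose (ν : ℝ) (hν : -1 < ν) (m : ℕ) :
    Real.Gamma (2 * m + ν + 1) / (m.factorial * Real.Gamma (m + ν + 1))
      = Ring.choose (2 * m + ν) m := by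
  have hp : 0 < (m:ℝ) + ν + 1 := by
    have : (0:ℝ) ≤ m := by positivity
    linarith
  have h := bgamma_asc (m + ν + 1) hp m
  have hg := bgamma_pos ν hν m
  have hd := Ring.descPochhammer_eq_factorial_smul_choose (2 * m + ν : ℝ) m
  rw [Polynomial.descPochhammer_smeval_eq_ascPochhammer, Polynomial.ascPochhammer_smeval_eq_eval,
    nsmul_eq_mul, show (2 * m + ν : ℝ) - m + 1 = m + ν + 1 by ring] at hd
  rw [show 2 * (m:ℝ) + ν + 1 = m + ν + 1 + m by ring, ← h, hd]
  have : (m.factorial : ℝ) ≠ 0 := by positivity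
  field_simp

lemma bseries (ν : ℝ) (hν : -1 < ν) (w : ℂ) (hw : ‖w‖ < 2 / 9) :
    HasSum (fun m : ℕ => ((Real.Gamma (2 * m + ν + 1) / (m.factorial * Real.Gamma (m + ν + 1)) : ℝ) : ℂ)
        * w ^ m)
      ((2 * π * Complex.I : ℂ)⁻¹ • ∮ z in C(0, 1/2), (z - w * (1 + z) ^ 2)⁻¹ • (1 + z) ^ (ν : ℂ)) := by
  have e : ∀ m : ℕ, ((Real.Gamma (2 * m + ν + 1) / (m.factorial * Real.Gamma (m + ν + 1)) : ℝ) : ℂ)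
        * w ^ m = (2 * π * Complex.I : ℂ)⁻¹ • ∮ z in C(0, 1/2),
          (w * (1 + z) ^ 2 / z) ^ m • (z⁻¹ • (1 + z) ^ (ν : ℂ)) := by
    intro m
    rw [bchoose ν hν m, Complex.ofReal_choose, ← bcauchy, mul_comm, ← smul_eq_mul, smul_comm,
      ← circleIntegral.integral_smul]
    congr 1
    apply circleIntegral.integral_congr (by norm_num)
    intro z hz
    have hs := bmem_slit (Metric.sphere_subset_closedBall hz)
    have h0 := Complex.slitPlane_ne_zero hs
    simp only [smul_eq_mul]
    push_cast
    rw [Complex.cpow_add _ _ h0, show (2 * m : ℂ) = ((2 * m : ℕ) : ℂ) by push_cast; ring,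
      Complex.cpow_natCast, pow_mul, div_pow, div_pow, mul_pow]
    ring
  simp only [e]
  apply HasSum.const_smul
  set q := ‖w‖ * (9 / 2) with hq
  have hq0 : 0 ≤ q := by positivity
  have hq1 : q < 1 := by rw [hq]; linarith
  have hz0 : ∀ z ∈ Metric.sphere (0:ℂ) (1/2), z ≠ 0 := by
    rintro z hz rfl
    simp at hz
  have hqz : ∀ z ∈ Metric.sphere (0:ℂ) (1/2), ‖w * (1 + z) ^ 2 / z‖ ≤ q := by
    intro z hz
    have hn : ‖z‖ = 1/2 := by simpa using hz
    have h1 : ‖1 + z‖ ≤ 3/2 := by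
      calc ‖1 + z‖ ≤ ‖(1:ℂ)‖ + ‖z‖ := norm_add_le _ _
        _ = 3/2 := by rw [hn]; norm_num
    rw [norm_div, norm_mul, norm_pow, hn]
    have : ‖1 + z‖ ^ 2 ≤ (3/2) ^ 2 := by gcongr
    have hw0 := norm_nonneg w
    rw [div_le_iff₀ (by norm_num)]
    nlinarith
  have hcont : ContinuousOn (fun z : ℂ => z⁻¹ • (1 + z) ^ (ν : ℂ)) (Metric.sphere 0 (1/2)) :=
    (continuousOn_id.inv₀ hz0).smul
      ((bdiffOn ν).continuousOn.mono Metric.sphere_subset_closedBall)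
  have hcontq : ContinuousOn (fun z : ℂ => w * (1 + z) ^ 2 / z) (Metric.sphere 0 (1/2)) :=
    ContinuousOn.div (by fun_prop) continuousOn_id hz0
  have hmem : ∀ θ : ℝ, circleMap (0:ℂ) (1/2) θ ∈ Metric.sphere (0:ℂ) (1/2) :=
    fun θ => circleMap_mem_sphere _ (by norm_num) θ
  have hcomp : ∀ f : ℂ → ℂ, ContinuousOn f (Metric.sphere 0 (1/2)) →
      Continuous fun θ : ℝ => f (circleMap (0:ℂ) (1/2) θ) := fun f hf =>
    hf.comp_continuous (continuous_circleMap _ _) hmem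
  have c1 := hcomp _ hcont
  have c2 := hcomp _ hcontq
  have c3 : Continuous (deriv (circleMap (0:ℂ) (1/2))) := by
    have : deriv (circleMap (0:ℂ) (1/2)) = fun θ => circleMap 0 (1/2) θ * Complex.I := by
      ext θ; simp
    rw [this]
    fun_prop
  unfold circleIntegral
  refine intervalIntegral.hasSum_integral_of_dominated_convergence
    (fun n θ => ‖deriv (circleMap (0:ℂ) (1/2)) θ • ((circleMap (0:ℂ) (1/2) θ)⁻¹ •
      (1 + circleMap (0:ℂ) (1/2) θ) ^ (ν : ℂ))‖ * q ^ n) (fun n => ?_) (fun n => ?_) ?_ ?_ ?_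
  · exact (c3.smul ((c2.pow n).smul c1)).aestronglyMeasurable
  · refine Filter.Eventually.of_forall fun θ _ => ?_
    rw [smul_comm, norm_smul, norm_pow, mul_comm]
    gcongr
    exact hqz _ (hmem θ)
  · exact Filter.Eventually.of_forall fun _ _ => (summable_geometric_of_lt_one hq0 hq1).mul_left _
  · simp only [tsum_mul_left]
    exact ((c3.smul c1).norm.mul continuous_const).intervalIntegrable _ _
  · refine Filter.Eventually.of_forall fun θ _ => ?_
    apply HasSum.const_smul
    have hlt : ‖w * (1 + circleMap (0:ℂ) (1/2) θ) ^ 2 / circleMap (0:ℂ) (1/2) θ‖ < 1 :=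
      (hqz _ (hmem θ)).trans_lt hq1
    have hh := (hasSum_geometric_of_norm_lt_one hlt).smul_const
      ((circleMap (0:ℂ) (1/2) θ)⁻¹ • (1 + circleMap (0:ℂ) (1/2) θ) ^ (ν : ℂ))
    have h0 := hz0 _ (hmem θ)
    rw [← mul_smul, ← mul_inv, sub_mul, div_mul_cancel₀ _ h0, one_mul] at hh
    exact hh

lemma bseries_eval (ν : ℝ) (hν : -1 < ν) (s : ℝ) (hs : 2 < s) :
    HasSum (fun m : ℕ => Real.Gamma (2 * m + ν + 1) / (m.factorial * Real.Gamma (m + ν + 1))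
        * (-1 / (4 * s ^ 2)) ^ m)
      ((2 * s * (√(s ^ 2 + 1) - s)) ^ ν * (s / √(s ^ 2 + 1))) := by
  set r := √(s ^ 2 + 1) with hr
  have hr2 : r ^ 2 = s ^ 2 + 1 := Real.sq_sqrt (by positivity)
  have hr0 : 0 < r := Real.sqrt_pos.mpr (by positivity)
  have hrs : s < r := by nlinarith
  set p := r - s with hp
  have hp0 : 0 < p := by linarith
  have hps : p * (r + s) = 1 := by rw [hp]; nlinarith
  have hp4 : p < 1 / 4 := by nlinarith
  have h1p : 1 - p ^ 2 = 2 * s * p := by rw [hp]; nlinarith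
  have hw : ‖((-1 / (4 * s ^ 2) : ℝ) : ℂ)‖ < 2 / 9 := by
    rw [Complex.norm_real, Real.norm_eq_abs, abs_div, abs_neg, abs_one,
      abs_of_pos (by positivity), div_lt_iff₀ (by positivity)]
    nlinarith
  have H := bseries ν hν _ hw
  rw [← Complex.hasSum_ofReal]
  push_cast at H ⊢
  convert H using 1
  have hsC : (s : ℂ) ≠ 0 := by exact_mod_cast (by linarith : s ≠ 0)
  have hrC : (r : ℂ) ≠ 0 := by exact_mod_cast hr0.ne'
  have hr2C : (r : ℂ) ^ 2 = s ^ 2 + 1 := by exact_mod_cast hr2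
  have hpC : (p : ℂ) = r - s := by rw [hp]; push_cast; ring
  have hne : ∀ z ∈ Metric.closedBall (0:ℂ) (1/2), z + (r + s) ^ 2 ≠ 0 := by
    intro z hz h
    have hz' := mem_closedBall_zero_iff.mp hz
    have : z = -(((r + s) ^ 2 : ℝ) : ℂ) := by push_cast; linear_combination h
    rw [this, norm_neg, Complex.norm_real, Real.norm_of_nonneg (by positivity)] at hz'
    nlinarith
  have hd : DifferentiableOn ℂ (fun z : ℂ => 4 * (s:ℂ) ^ 2 / (z + (r + s) ^ 2) * (1 + z) ^ (ν : ℂ))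
      (Metric.closedBall 0 (1/2)) := by
    refine DifferentiableOn.mul (DifferentiableOn.div (by fun_prop) (by fun_prop) hne) (bdiffOn _)
  have hmem : (-(p:ℂ) ^ 2) ∈ Metric.ball (0:ℂ) (1/2) := by
    rw [mem_ball_zero_iff, norm_neg, norm_pow, Complex.norm_real, Real.norm_of_nonneg hp0.le]
    nlinarith
  have hC := hd.circleIntegral_sub_inv_smul hmem
  have hI : (∮ z in C(0, 1/2), (z - -1 / (4 * (s:ℂ) ^ 2) * (1 + z) ^ 2)⁻¹ • (1 + z) ^ (ν : ℂ))
      = ∮ z in C(0, 1/2), (z - -(p:ℂ) ^ 2)⁻¹ •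
        (4 * (s:ℂ) ^ 2 / (z + (r + s) ^ 2) * (1 + z) ^ (ν : ℂ)) := by
    congr 1
    ext z
    simp only [smul_eq_mul]
    rw [← mul_assoc]
    congr 1
    have : z - -1 / (4 * (s:ℂ) ^ 2) * (1 + z) ^ 2
        = (z - -(p:ℂ) ^ 2) * (z + (r + s) ^ 2) / (4 * (s:ℂ) ^ 2) := by
      field_simp
      rw [hpC]
      linear_combination (-2 * z + (s:ℂ) ^ 2 * 1 - r ^ 2 - 1) * hr2C
    rw [this, inv_div, mul_comm ((z - -(p:ℂ)^2)), ← div_div, div_eq_mul_inv, mul_comm]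
  rw [hI, hC, smul_smul, inv_mul_cancel₀ Complex.two_pi_I_ne_zero, one_smul]
  have e1 : (1 + -(p:ℂ) ^ 2) = ((2 * s * p : ℝ) : ℂ) := by
    rw [← h1p]; push_cast; ring
  have e2 : (-(p:ℂ) ^ 2 + (r + s) ^ 2) = 4 * s * r := by
    rw [hpC]; ring
  rw [e1, e2, ← Complex.ofReal_cpow (by positivity), mul_comm]
  congr 1
  field_simp

lemma bint (a : ℝ) (ha : -1 < a) (s : ℝ) (hs : 0 < s) :
    IntegrableOn (fun x : ℝ => x ^ a * Real.exp (-(s * x))) (Set.Ioi 0) := by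
  have := integrableOn_rpow_mul_exp_neg_mul_rpow (p := 1) ha one_pos hs
  simpa using this

lemma breal (ν : ℝ) (hν : -1 < ν) (s : ℝ) (hs : 2 < s) :
    ∫ x in Set.Ioi (0 : ℝ), Real.exp (-(s * x)) * besselJ ν x
      = (√(s ^ 2 + 1) - s) ^ ν / √(s ^ 2 + 1) := by
  have hs0 : 0 < s := by linarith
  have hS := bseries_eval ν hν s hs
  have hexp : ∀ m : ℕ, -1 < 2 * (m : ℝ) + ν := fun m => by
    have : (0:ℝ) ≤ m := by positivity
    linarith
  set F : ℕ → ℝ → ℝ := fun m x => (-1 : ℝ) ^ m / (m.factorial * Real.Gamma (m + ν + 1)) /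
    2 ^ (2 * (m : ℝ) + ν) * (x ^ (2 * (m : ℝ) + ν) * Real.exp (-(s * x))) with hF
  have hi : ∀ m : ℕ, ∫ x in Set.Ioi (0 : ℝ), x ^ (2 * (m : ℝ) + ν) * Real.exp (-(s * x))
      = (1 / s) ^ (2 * (m : ℝ) + ν + 1) * Real.Gamma (2 * m + ν + 1) := fun m => by
    have := Real.integral_rpow_mul_exp_neg_mul_Ioi (a := 2 * (m : ℝ) + ν + 1) (r := s)
      (by linarith [hexp m]) hs0
    simpa using this
  have hpw : ∀ m : ℕ, (1 / s) ^ (2 * (m : ℝ) + ν + 1) / 2 ^ (2 * (m : ℝ) + ν)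
      = (2 * s) ^ (-ν) / s * (1 / (4 * s ^ 2)) ^ m := fun m => by
    rw [one_div, Real.inv_rpow hs0.le, Real.rpow_add hs0, Real.rpow_one, ← one_div, mul_comm (s ^ _),
      ← div_div, div_div _ (s ^ _), ← Real.mul_rpow hs0.le (by norm_num), Real.rpow_add (by positivity),
      Real.rpow_neg (by positivity), mul_comm s 2, Real.rpow_mul (by positivity), Real.rpow_natCast,
      show (2 * s) ^ (2:ℝ) = 4 * s ^ 2 by
        rw [show (2:ℝ) = (2:ℕ) by norm_num, Real.rpow_natCast]; push_cast; ring,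
      one_div, one_div, inv_pow]
    ring
  have hFi : ∀ m, ∫ x in Set.Ioi (0 : ℝ), F m x = (2 * s) ^ (-ν) / s *
      (Real.Gamma (2 * m + ν + 1) / (m.factorial * Real.Gamma (m + ν + 1))
        * (-1 / (4 * s ^ 2)) ^ m) := fun m => by
    simp only [hF]
    have hpm := hpw m
    rw [integral_const_mul, hi m, neg_div, neg_pow (1 / (4 * s ^ 2))]
    generalize (1 / (4 * s ^ 2)) ^ m = Y at hpm ⊢
    linear_combination (-1 : ℝ) ^ m / (m.factorial * Real.Gamma (m + ν + 1)) *
      Real.Gamma (2 * m + ν + 1) * hpm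
  have hFn : ∀ m, ∫ x in Set.Ioi (0 : ℝ), ‖F m x‖ = |∫ x in Set.Ioi (0 : ℝ), F m x| := fun m => by
    simp only [hF]
    rw [integral_const_mul, abs_mul, abs_of_nonneg (a := ∫ x in Set.Ioi (0 : ℝ), _),
      ← integral_const_mul]
    · refine setIntegral_congr_fun measurableSet_Ioi fun x hx => ?_
      have hx0 : 0 < x := hx
      rw [norm_mul, Real.norm_eq_abs, Real.norm_of_nonneg (by positivity)]
    · refine setIntegral_nonneg measurableSet_Ioi fun x hx => ?_
      have hx0 : 0 < x := hx
      positivity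
  have hsum := hasSum_integral_of_summable_integral_norm (μ := volume.restrict (Set.Ioi (0:ℝ)))
    (F := F) (fun m => (bint _ (hexp m) s hs0).const_mul _) (by
      simp only [hFn, hFi]
      exact (hS.summable.mul_left _).abs)
  simp only [hFi] at hsum
  have heq := hsum.unique (hS.mul_left _)
  have hJ : ∫ x in Set.Ioi (0 : ℝ), Real.exp (-(s * x)) * besselJ ν x
      = ∫ x in Set.Ioi (0 : ℝ), ∑' m, F m x := by
    refine setIntegral_congr_fun measurableSet_Ioi fun x hx => ?_
    have hx0 : 0 < x := hx
    simp only [besselJ, hF]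
    rw [← tsum_mul_left]
    congr 1
    ext m
    rw [Real.div_rpow hx0.le (by norm_num)]
    ring
  rw [hJ, heq]
  have hr0 : 0 < √(s ^ 2 + 1) := Real.sqrt_pos.mpr (by positivity)
  have hq : 0 ≤ √(s ^ 2 + 1) - s := by
    rw [sub_nonneg]
    exact Real.le_sqrt_of_sq_le (by linarith)
  have h2 : (0:ℝ) < (2 * s) ^ ν := by positivity
  rw [Real.mul_rpow (by positivity) hq, Real.rpow_neg (by positivity)]
  field_simp

lemma besselJ_bound (ν : ℝ) (hν : -1 < ν) :
    ∃ K : ℝ, ∀ x : ℝ, 0 < x → |besselJ ν x| ≤ K * (x ^ ν + x ^ (ν + 2)) := by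
  obtain ⟨C, hC0, hC⟩ := bphi_bound ν hν
  refine ⟨C / 2 ^ ν, fun x hx => ?_⟩
  rw [besselJ_eq_bphi ν x hx, abs_mul, abs_of_pos (by positivity), Real.div_rpow hx.le (by norm_num),
    Real.rpow_add hx, show x ^ (2:ℝ) = x ^ 2 by
        rw [show (2:ℝ) = (2:ℕ) by norm_num, Real.rpow_natCast]]
  have h := hC (x ^ 2 / 4) (by positivity)
  calc x ^ ν / 2 ^ ν * |bphi ν (x ^ 2 / 4)| ≤ x ^ ν / 2 ^ ν * (C * (1 + x ^ 2)) := by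
        gcongr
        refine h.trans ?_
        gcongr
        nlinarith [sq_nonneg x]
    _ = _ := by ring

lemma besselJ_contOn (ν : ℝ) (hν : -1 < ν) : ContinuousOn (besselJ ν) (Set.Ioi 0) := by
  have h : ContinuousOn (fun x : ℝ => (x / 2) ^ ν * bphi ν (x ^ 2 / 4)) (Set.Ioi 0) := by
    have hc : Continuous (bphi ν) :=
      continuous_iff_continuousAt.mpr fun t => (bphi_hasDerivAt ν hν t).continuousAt
    refine ContinuousOn.mul ?_ (by fun_prop)
    refine ContinuousOn.rpow_const (by fun_prop) fun x hx => Or.inl ?_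
    have hx0 : 0 < x := hx
    positivity
  exact h.congr fun x hx => besselJ_eq_bphi ν x hx

noncomputable def blap (ν : ℝ) (s : ℂ) : ℂ :=
  ∫ x in Set.Ioi (0 : ℝ), Complex.exp (-(s * x)) * (besselJ ν x : ℂ)

lemma blap_diff (ν : ℝ) (hν : -1 < ν) : DifferentiableOn ℂ (blap ν) {s : ℂ | 0 < s.re} := by
  obtain ⟨K, hK⟩ := besselJ_bound ν hν
  intro s hs
  have hs0 : 0 < s.re := hs
  apply DifferentiableAt.differentiableWithinAt
  have hcJ : ContinuousOn (fun x : ℝ => (besselJ ν x : ℂ)) (Set.Ioi 0) :=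
    Complex.continuous_ofReal.comp_continuousOn (besselJ_contOn ν hν)
  have hm : ∀ z : ℂ, AEStronglyMeasurable
      (fun x : ℝ => Complex.exp (-(z * x)) * (besselJ ν x : ℂ)) (volume.restrict (Set.Ioi 0)) :=
    fun z => (ContinuousOn.mul (by fun_prop) hcJ).aestronglyMeasurable measurableSet_Ioi
  have hm' : ∀ z : ℂ, AEStronglyMeasurable
      (fun x : ℝ => -(x : ℂ) * (Complex.exp (-(z * x)) * (besselJ ν x : ℂ)))
      (volume.restrict (Set.Ioi 0)) :=
    fun z => (ContinuousOn.mul (by fun_prop) (ContinuousOn.mul (by fun_prop) hcJ)).aestronglyMeasurable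
      measurableSet_Ioi
  have hn : ∀ (z : ℂ) (x : ℝ), 0 < x → ‖Complex.exp (-(z * x)) * (besselJ ν x : ℂ)‖
      ≤ K * (x ^ ν * Real.exp (-(z.re * x)) + x ^ (ν + 2) * Real.exp (-(z.re * x))) := by
    intro z x hx
    rw [norm_mul, Complex.norm_exp, Complex.norm_real, Real.norm_eq_abs]
    have h1 : (-(z * (x:ℂ))).re = -(z.re * x) := by simp
    rw [h1]
    calc _ ≤ Real.exp (-(z.re * x)) * (K * (x ^ ν + x ^ (ν + 2))) := by
          gcongr
          exact hK x hx
      _ = _ := by ring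
  have key := hasDerivAt_integral_of_dominated_loc_of_deriv_le (𝕜 := ℂ)
    (μ := volume.restrict (Set.Ioi (0:ℝ)))
    (F := fun (z : ℂ) (x : ℝ) => Complex.exp (-(z * x)) * (besselJ ν x : ℂ))
    (F' := fun (z : ℂ) (x : ℝ) => -(x : ℂ) * (Complex.exp (-(z * x)) * (besselJ ν x : ℂ)))
    (x₀ := s) (s := {z : ℂ | s.re / 2 < z.re})
    (bound := fun x => K * (x ^ (ν + 1) * Real.exp (-(s.re / 2 * x))
      + x ^ (ν + 3) * Real.exp (-(s.re / 2 * x))))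
    ((isOpen_lt continuous_const Complex.continuous_re).mem_nhds (by
      change s.re / 2 < s.re; linarith))
    (Filter.Eventually.of_forall hm) ?_ (hm' s) ?_ ?_ ?_
  · exact key.2.differentiableAt
  · refine Integrable.mono' (((bint ν hν s.re hs0).add
      (bint (ν + 2) (by linarith) s.re hs0)).const_mul K) (hm s) ?_
    exact (ae_restrict_mem measurableSet_Ioi).mono fun x hx => hn s x hx
  · refine (ae_restrict_mem measurableSet_Ioi).mono fun x hx z hz => ?_
    have hx0 : 0 < x := hx
    have hz' : s.re / 2 < z.re := hz
    have hK0 : 0 ≤ K * (x ^ ν + x ^ (ν + 2)) := (abs_nonneg _).trans (hK x hx0)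
    rw [norm_mul, norm_neg, Complex.norm_real, Real.norm_of_nonneg hx0.le]
    have he : Real.exp (-(z.re * x)) ≤ Real.exp (-(s.re / 2 * x)) := by
      gcongr
    calc _ ≤ x * (K * (x ^ ν * Real.exp (-(z.re * x)) + x ^ (ν + 2) * Real.exp (-(z.re * x)))) := by
          gcongr
          exact hn z x hx0
      _ = x * ((K * (x ^ ν + x ^ (ν + 2))) * Real.exp (-(z.re * x))) := by ring
      _ ≤ x * ((K * (x ^ ν + x ^ (ν + 2))) * Real.exp (-(s.re / 2 * x))) := by gcongr
      _ = _ := by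
          rw [show ν + 3 = (ν + 2) + 1 by ring, Real.rpow_add hx0 (ν + 2), Real.rpow_add hx0 ν 1,
            Real.rpow_one]
          ring
  · exact ((bint (ν + 1) (by linarith) _ (by linarith)).add
      (bint (ν + 3) (by linarith) _ (by linarith))).const_mul K
  · refine Filter.Eventually.of_forall fun x z _ => ?_
    have h1 : HasDerivAt (fun z : ℂ => -(z * (x:ℂ))) (-(x:ℂ)) z := by
      simpa using! ((hasDerivAt_id z).mul_const (x:ℂ)).neg
    refine (h1.cexp.mul_const (besselJ ν x : ℂ)).congr_deriv ?_
    ring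

noncomputable def bG (ν : ℝ) (s : ℂ) : ℂ :=
  ((s ^ 2 + 1) ^ (1 / 2 : ℂ) + s) ^ (-ν : ℂ) / (s ^ 2 + 1) ^ (1 / 2 : ℂ)

lemma bG_diff (ν : ℝ) : DifferentiableOn ℂ (bG ν) {s : ℂ | 0 < s.re} := by
  intro s hs
  have hs0 : 0 < s.re := hs
  apply DifferentiableAt.differentiableWithinAt
  have h1 : s ^ 2 + 1 ∈ Complex.slitPlane := by
    rw [Complex.mem_slitPlane_iff]
    by_contra h
    push Not at h
    obtain ⟨ha, hb⟩ := h
    simp [pow_two] at ha hb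
    have : s.im = 0 := by
      rcases mul_eq_zero.mp (by linarith : s.re * s.im = 0) with h | h
      · linarith
      · exact h
    rw [this] at ha
    nlinarith
  have hne := Complex.slitPlane_ne_zero h1
  have hre : 0 ≤ ((s ^ 2 + 1) ^ (1 / 2 : ℂ)).re := by
    rw [Complex.cpow_def_of_ne_zero hne, Complex.exp_re]
    apply mul_nonneg (Real.exp_pos _).le
    apply Real.cos_nonneg_of_neg_pi_div_two_le_of_le
    all_goals
      have := Complex.neg_pi_lt_arg (s ^ 2 + 1)
      have := Complex.arg_le_pi (s ^ 2 + 1)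
      simp [Complex.mul_im, Complex.log_im]
      linarith
  have h2 : (s ^ 2 + 1) ^ (1 / 2 : ℂ) + s ∈ Complex.slitPlane := by
    rw [Complex.mem_slitPlane_iff]
    left
    rw [Complex.add_re]
    linarith
  have d1 : DifferentiableAt ℂ (fun s : ℂ => (s ^ 2 + 1) ^ (1 / 2 : ℂ)) s :=
    DifferentiableAt.cpow (by fun_prop) (by fun_prop) h1
  unfold bG
  refine DifferentiableAt.div (DifferentiableAt.cpow (d1.add differentiableAt_id) (by fun_prop) h2) d1 ?_
  rw [Complex.cpow_def_of_ne_zero hne]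
  exact Complex.exp_ne_zero _

lemma bG_real (ν s : ℝ) (hs : 0 < s) :
    bG ν s = (((√(s ^ 2 + 1) - s) ^ ν / √(s ^ 2 + 1) : ℝ) : ℂ) := by
  unfold bG
  have e : ((s:ℂ) ^ 2 + 1) ^ (1 / 2 : ℂ) = ((√(s ^ 2 + 1) : ℝ) : ℂ) := by
    rw [Real.sqrt_eq_rpow, Complex.ofReal_cpow (by positivity)]
    push_cast
    rfl
  have hr2 : √(s ^ 2 + 1) ^ 2 = s ^ 2 + 1 := Real.sq_sqrt (by positivity)
  have hr0 : 0 < √(s ^ 2 + 1) := Real.sqrt_pos.mpr (by positivity)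
  have hq : √(s ^ 2 + 1) - s = (√(s ^ 2 + 1) + s)⁻¹ := by
    rw [← mul_eq_one_iff_eq_inv₀ (by positivity)]
    linear_combination hr2
  rw [e, hq, Real.inv_rpow (by positivity), ← Real.rpow_neg (by positivity)]
  push_cast [Complex.ofReal_cpow (by positivity : 0 ≤ √(s ^ 2 + 1) + s)]
  rfl

lemma blap_real (ν s : ℝ) :
    blap ν s = ((∫ x in Set.Ioi (0 : ℝ), Real.exp (-(s * x)) * besselJ ν x : ℝ) : ℂ) := by
  unfold blap
  rw [← integral_complex_ofReal]
  congr 1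
  ext x
  push_cast
  rfl

lemma blap_eq (ν : ℝ) (hν : -1 < ν) : Set.EqOn (blap ν) (bG ν) {s : ℂ | 0 < s.re} := by
  have ho : IsOpen {s : ℂ | 0 < s.re} := isOpen_lt continuous_const Complex.continuous_re
  refine AnalyticOnNhd.eqOn_of_preconnected_of_frequently_eq ((blap_diff ν hν).analyticOnNhd ho)
    ((bG_diff ν).analyticOnNhd ho) (convex_halfSpace_re_gt 0).isPreconnected
    (z₀ := ((3:ℝ) : ℂ)) (by simp) ?_
  have h_real : ∃ᶠ x : ℝ in nhdsWithin 3 {3}ᶜ, blap ν x = bG ν x := by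
    apply Filter.Eventually.frequently
    have : ∀ᶠ x : ℝ in nhds 3, 2 < x := lt_mem_nhds (by norm_num)
    refine (this.filter_mono nhdsWithin_le_nhds).mono fun x hx => ?_
    rw [blap_real, breal ν hν x hx, bG_real ν x (by linarith)]
  have ht : Filter.Tendsto (fun x : ℝ => (x : ℂ)) (nhdsWithin 3 {3}ᶜ)
      (nhdsWithin ((3:ℝ) : ℂ) {((3:ℝ) : ℂ)}ᶜ) := by
    apply Complex.continuous_ofReal.continuousWithinAt.tendsto_nhdsWithin
    intro x hx h
    apply hx
    exact Complex.ofReal_injective h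
  exact ht.frequently h_real

lemma blap_final (ν : ℝ) (hν : -1 < ν) (s : ℝ) (hs : 0 < s) :
    ∫ x in Set.Ioi (0 : ℝ), Real.exp (-(s * x)) * besselJ ν x
      = (√(s ^ 2 + 1) - s) ^ ν / √(s ^ 2 + 1) := by
  have h := blap_eq ν hν (x := (s : ℂ)) (by simpa using hs)
  rw [blap_real, bG_real ν s hs] at h
  exact_mod_cast h

theorem laplace_transform_besselJ (ν α β : ℝ) (hν : -1 < ν) (hα : 0 < α) (hβ : 0 < β) :
    ∫ x in Set.Ioi (0 : ℝ), Real.exp (-α * x) * besselJ ν (β * x)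
      = (Real.sqrt (α ^ 2 + β ^ 2) - α) ^ ν / (β ^ ν * Real.sqrt (α ^ 2 + β ^ 2)) := by
  have hs : 0 < α / β := by positivity
  have h := integral_comp_mul_left_Ioi
    (fun y => Real.exp (-(α / β * y)) * besselJ ν y) 0 hβ
  rw [mul_zero, blap_final ν hν _ hs] at h
  have e : ∀ x : ℝ, -(α / β * (β * x)) = -α * x := fun x => by field_simp
  simp only [e] at h
  rw [h]
  have hr : √(α ^ 2 + β ^ 2) = β * √((α / β) ^ 2 + 1) := by
    rw [show α ^ 2 + β ^ 2 = β ^ 2 * ((α / β) ^ 2 + 1) by field_simp,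
      Real.sqrt_mul (by positivity), Real.sqrt_sq hβ.le]
  have hq : 0 ≤ √((α / β) ^ 2 + 1) - α / β := by
    rw [sub_nonneg]
    exact Real.le_sqrt_of_sq_le (by linarith)
  have hr0 : 0 < √((α / β) ^ 2 + 1) := Real.sqrt_pos.mpr (by positivity)
  have hb : 0 < β ^ ν := by positivity
  rw [hr, show β * √((α / β) ^ 2 + 1) - α = β * (√((α / β) ^ 2 + 1) - α / β) by field_simp,
    Real.mul_rpow hβ.le hq, smul_eq_mul]
  generalize (√((α / β) ^ 2 + 1) - α / β) ^ ν = X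
  field_simp
end

section
/- For α > 0, β ≥ 0, γ ≥ 0, ∫₀^∞ e^{-αx} J₀(β√(x² + 2γx)) dx = (1/√(α²+β²)) · e^{γ(α − √(α²+β²))}. -/
open MeasureTheory Real

theorem circ (f : ℂ → ℂ) : circleIntegral f 0 1 =
    ∫ θ in (0:ℝ)..2 * π, circleMap 0 1 θ * Complex.I * f (circleMap 0 1 θ) := by
  simp [circleIntegral]

theorem w_ne (θ : ℝ) : circleMap 0 1 θ ≠ 0 := by simp [circleMap]

theorem coeff (a : ℂ) (n : ℕ) :
    ∫ θ in (0:ℝ)..2 * π, Complex.exp (a * circleMap 0 1 θ) * ((circleMap 0 1 θ)⁻¹) ^ n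
      = 2 * π * (a ^ n / n.factorial) := by
  have h : DiffContOnCl ℂ (fun s : ℂ => Complex.exp (a * s)) (Metric.ball 0 1) :=
    Differentiable.diffContOnCl (by fun_prop)
  have := h.circleIntegral_one_div_sub_center_pow_smul one_pos n
  rw [circ, iteratedDeriv_cexp_const_mul] at this
  have h2 : ∀ θ : ℝ, circleMap 0 1 θ * Complex.I * ((1 / (circleMap 0 1 θ - 0) ^ (n + 1)) •
      Complex.exp (a * circleMap 0 1 θ))
      = Complex.I * (Complex.exp (a * circleMap 0 1 θ) * ((circleMap 0 1 θ)⁻¹) ^ n) := by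
    intro θ
    have := w_ne θ
    simp only [sub_zero, smul_eq_mul, pow_succ, inv_pow]
    field_simp
  simp only [h2, intervalIntegral.integral_const_mul] at this
  apply mul_left_cancel₀ Complex.I_ne_zero
  rw [this]
  simp
  ring

theorem gen (a b : ℂ) :
    ∫ θ in (0:ℝ)..2 * π, Complex.exp (a * circleMap 0 1 θ + b * (circleMap 0 1 θ)⁻¹)
      = 2 * π * ∑' n : ℕ, (a * b) ^ n / (n.factorial * n.factorial : ℂ) := by
  have key := intervalIntegral.hasSum_integral_of_dominated_convergence (μ := volume)
    (a := 0) (b := 2 * π)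
    (F := fun (n : ℕ) (θ : ℝ) => b ^ n / n.factorial *
      (Complex.exp (a * circleMap 0 1 θ) * ((circleMap 0 1 θ)⁻¹) ^ n))
    (f := fun θ => Complex.exp (a * circleMap 0 1 θ + b * (circleMap 0 1 θ)⁻¹))
    (fun n θ => ‖b‖ ^ n / n.factorial * Real.exp ‖a‖) ?_ ?_ ?_ ?_ ?_
  · simp only [intervalIntegral.integral_const_mul, coeff] at key
    rw [← key.tsum_eq, ← tsum_mul_left]
    congr 1; ext n
    rw [mul_pow]; field_simp
  · intro n
    apply Continuous.aestronglyMeasurable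
    have : Continuous fun θ : ℝ => (circleMap 0 1 θ)⁻¹ := (by fun_prop : Continuous (circleMap 0 1)).inv₀ w_ne
    fun_prop
  · intro n
    refine .of_forall fun θ _ => ?_
    rw [norm_mul, norm_mul, Complex.norm_exp, norm_div, norm_pow]
    have : (a * circleMap 0 1 θ).re ≤ ‖a‖ := (Complex.re_le_norm _).trans (by simp)
    simp
    gcongr
    simpa using this
  · refine .of_forall fun θ _ => ?_
    exact (Real.summable_pow_div_factorial _).mul_right _
  · simp
  · refine .of_forall fun θ _ => ?_
    have := NormedSpace.expSeries_div_hasSum_exp (b * (circleMap 0 1 θ)⁻¹)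
    rw [← Complex.exp_eq_exp_ℂ] at this
    have := this.mul_left (Complex.exp (a * circleMap 0 1 θ))
    rw [← Complex.exp_add] at this
    have e : ∀ n : ℕ, b ^ n / n.factorial *
        (Complex.exp (a * circleMap 0 1 θ) * ((circleMap 0 1 θ)⁻¹) ^ n) =
        Complex.exp (a * circleMap 0 1 θ) * ((b * (circleMap 0 1 θ)⁻¹) ^ n / n.factorial) := by
      intro n
      rw [mul_pow]; ring
    simp only [e]
    exact this

theorem bess (β γ x : ℝ) (hx : 0 ≤ x) (hγ : 0 ≤ γ) :
    (besselJ 0 (β * Real.sqrt (x ^ 2 + 2 * γ * x)) : ℂ) =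
     (2 * π : ℂ)⁻¹ * ∫ θ in (0:ℝ)..2 * π, Complex.exp
      ((Complex.I * β * (x + 2 * γ) / 2) * circleMap 0 1 θ + (Complex.I * β * x / 2) * (circleMap 0 1 θ)⁻¹) := by
  rw [gen, inv_mul_cancel_left₀ (by simp [Real.pi_ne_zero]), besselJ, Complex.ofReal_tsum]
  congr 1; ext m
  have h1 : (2 * (m:ℝ) + 0) = ((2 * m : ℕ) : ℝ) := by push_cast; ring
  rw [h1, Real.rpow_natCast, add_zero, Real.Gamma_nat_eq_factorial, pow_mul, div_pow, mul_pow,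
    Real.sq_sqrt (by positivity)]
  have : (Complex.I * β * (x + 2 * γ) / 2) * (Complex.I * β * x / 2)
    = (-1) * (β ^ 2 * (x ^ 2 + 2 * γ * x) / 2 ^ 2 : ℂ) := by
    linear_combination (β * (x + 2 * γ) / 2 * (β * x / 2) : ℂ) * Complex.I_sq
  rw [this, mul_pow]
  push_cast
  ring

/-- The contour integral evaluated by the Cauchy formula. -/
theorem contour (α β γ : ℝ) (hα : 0 < α) (hβ : 0 ≤ β) :
    ∫ θ in (0:ℝ)..2 * π, Complex.exp (Complex.I * β * γ * circleMap 0 1 θ) *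
      (α - Complex.I * β * (circleMap 0 1 θ + (circleMap 0 1 θ)⁻¹) / 2)⁻¹
    = 2 * π * ((1 / Real.sqrt (α ^ 2 + β ^ 2)) *
          Real.exp (γ * (α - Real.sqrt (α ^ 2 + β ^ 2))) : ℝ) := by
  set s := Real.sqrt (α ^ 2 + β ^ 2) with hs
  have hs2 : s ^ 2 = α ^ 2 + β ^ 2 := Real.sq_sqrt (by positivity)
  have hs0 : 0 < s := Real.sqrt_pos.2 (by positivity)
  have hsβ : β ≤ s := Real.le_sqrt_of_sq_le (by nlinarith)
  have hc0 : ((α + s : ℝ) : ℂ) ≠ 0 := Complex.ofReal_ne_zero.2 (by positivity)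
  have hs2c : (s : ℂ) ^ 2 = α ^ 2 + β ^ 2 := by exact_mod_cast hs2
  set w0 : ℂ := Complex.I * (β / (α + s) : ℝ) with hw0
  have hw0m : w0 ∈ Metric.ball (0:ℂ) 1 := by
    rw [mem_ball_zero_iff, hw0, norm_mul, Complex.norm_I, one_mul, Complex.norm_real,
      Real.norm_of_nonneg (by positivity), div_lt_one (by positivity)]
    linarith
  have hw0c : w0 * (α + s) = Complex.I * β := by
    rw [hw0]; push_cast; push_cast at hc0; field_simp
  have hw0β : Complex.I * β * w0 = α - s := by
    apply mul_right_cancel₀ hc0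
    push_cast
    linear_combination (Complex.I * β) * hw0c + (β:ℂ)^2 * Complex.I_sq + hs2c
  have hg : ∀ z ∈ Metric.closedBall (0:ℂ) 1, ((α + s) / 2 - Complex.I * β * z / 2 : ℂ) ≠ 0 := by
    intro z hz h
    rw [mem_closedBall_zero_iff] at hz
    have h1 : ((α + s : ℝ) : ℂ) = Complex.I * β * z := by push_cast; linear_combination 2 * h
    have h2 := congrArg norm h1
    rw [Complex.norm_real, Real.norm_of_nonneg (by positivity), norm_mul, norm_mul, Complex.norm_I,
      Complex.norm_real, Real.norm_of_nonneg hβ] at h2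
    nlinarith
  have hd : DifferentiableOn ℂ (fun z : ℂ => Complex.exp (Complex.I * β * γ * z) /
      ((α + s) / 2 - Complex.I * β * z / 2)) (Metric.closedBall 0 1) :=
    DifferentiableOn.div (by fun_prop) (by fun_prop) hg
  have := hd.circleIntegral_sub_inv_smul hw0m
  rw [circ] at this
  apply mul_left_cancel₀ Complex.I_ne_zero
  rw [← intervalIntegral.integral_const_mul]
  have e : ∀ θ : ℝ, Complex.I * (Complex.exp (Complex.I * β * γ * circleMap 0 1 θ) *
      (α - Complex.I * β * (circleMap 0 1 θ + (circleMap 0 1 θ)⁻¹) / 2)⁻¹) =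
      circleMap 0 1 θ * Complex.I * ((circleMap 0 1 θ - w0)⁻¹ •
      (Complex.exp (Complex.I * β * γ * circleMap 0 1 θ) /
      ((α + s) / 2 - Complex.I * β * circleMap 0 1 θ / 2))) := by
    intro θ
    have hz := w_ne θ
    set z := circleMap 0 1 θ
    have : (z - w0) * ((α + s) / 2 - Complex.I * β * z / 2) =
       z * (α - Complex.I * β * (z + z⁻¹) / 2) := by
      field_simp
      linear_combination (z) * hw0β - hw0c
    rw [smul_eq_mul, div_eq_mul_inv]
    calc _ = Complex.I * Complex.exp (Complex.I * β * γ * z) * z *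
          (z * (α - Complex.I * β * (z + z⁻¹) / 2))⁻¹ := by
            rw [mul_inv]; field_simp
      _ = _ := by rw [← this, mul_inv]; ring
  simp only [e]
  rw [this]
  have e1 : ((α + s) / 2 - Complex.I * β * w0 / 2 : ℂ) = s := by rw [hw0β]; ring
  have e2 : Complex.I * β * γ * w0 = γ * (α - s) := by linear_combination (γ:ℂ) * hw0β
  rw [e1, e2]
  push_cast
  rw [smul_eq_mul]
  ring

theorem wre (θ : ℝ) : (circleMap 0 1 θ + (circleMap 0 1 θ)⁻¹) / 2 = (Real.cos θ : ℂ) := by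
  simp only [circleMap, zero_add, Complex.ofReal_one, one_mul, ← Complex.exp_neg]
  rw [Complex.ofReal_cos, Complex.cos]
  simp

theorem laplace_transform_besselJ0_shifted (α β γ : ℝ) (hα : 0 < α) (hβ : 0 ≤ β) (hγ : 0 ≤ γ) :
    ∫ x in Set.Ioi (0 : ℝ),
        Real.exp (-α * x) * besselJ 0 (β * Real.sqrt (x ^ 2 + 2 * γ * x))
      = (1 / Real.sqrt (α ^ 2 + β ^ 2)) *
          Real.exp (γ * (α - Real.sqrt (α ^ 2 + β ^ 2))) := by
  apply Complex.ofReal_injective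
  rw [← integral_complex_ofReal]
  have e1 : ∀ x ∈ Set.Ioi (0:ℝ),
      ((Real.exp (-α * x) * besselJ 0 (β * Real.sqrt (x ^ 2 + 2 * γ * x)) : ℝ) : ℂ) =
      (2 * π : ℂ)⁻¹ * ∫ θ in Set.Ioc (0:ℝ) (2 * π),
        Complex.exp (Complex.I * β * γ * circleMap 0 1 θ) *
          Complex.exp ((-α + Complex.I * β * Real.cos θ) * x) := by
    intro x hx
    rw [Complex.ofReal_mul, bess β γ x (le_of_lt hx) hγ, mul_left_comm,
      ← intervalIntegral.integral_const_mul, intervalIntegral.integral_of_le (by positivity)]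
    congr 2
    ext θ
    rw [Complex.ofReal_exp, ← Complex.exp_add, ← Complex.exp_add, ← wre]
    congr 1
    push_cast
    ring
  rw [setIntegral_congr_fun measurableSet_Ioi e1, integral_const_mul, integral_integral_swap]
  · have e2 : ∀ θ : ℝ, ∫ x in Set.Ioi (0:ℝ), Complex.exp (Complex.I * β * γ * circleMap 0 1 θ) *
          Complex.exp ((-α + Complex.I * β * Real.cos θ) * x) =
        Complex.exp (Complex.I * β * γ * circleMap 0 1 θ) *
      (α - Complex.I * β * (circleMap 0 1 θ + (circleMap 0 1 θ)⁻¹) / 2)⁻¹ := by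
      intro θ
      rw [integral_const_mul, integral_exp_mul_complex_Ioi]
      · rw [mul_div_assoc, wre]
        simp only [Complex.ofReal_zero, mul_zero, Complex.exp_zero]
        congr 1
        rw [neg_div, ← div_neg, one_div]
        congr 1; ring
      · simp [-Complex.ofReal_cos]
        linarith
    simp only [e2]
    rw [← intervalIntegral.integral_of_le (by positivity), contour α β γ hα hβ,
      inv_mul_cancel_left₀ (by simp [Real.pi_ne_zero])]
  · have hb : Integrable (fun p : ℝ × ℝ => Real.exp (-α * p.1) * Real.exp (β * γ))
        ((volume.restrict (Set.Ioi 0)).prod (volume.restrict (Set.Ioc 0 (2 * π)))) := by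
      refine Integrable.mul_prod (f := fun x : ℝ => Real.exp (-α * x))
        (g := fun _ : ℝ => Real.exp (β * γ)) ?_ ?_
      · exact integrableOn_exp_mul_Ioi (by linarith) 0
      · exact integrable_const _
    refine hb.mono' (Continuous.aestronglyMeasurable ?_) (.of_forall ?_)
    · simp only [Function.uncurry_def]
      fun_prop
    · rintro ⟨x, θ⟩
      simp only [Function.uncurry_apply_pair, norm_mul, Complex.norm_exp]
      rw [mul_comm]
      have h1 : ((-α + Complex.I * β * Real.cos θ) * x : ℂ).re = -α * x := by
        simp [-Complex.ofReal_cos]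
      have h2 : (Complex.I * β * γ * circleMap 0 1 θ : ℂ).re ≤ β * γ := by
        refine (Complex.re_le_norm _).trans ?_
        simp [abs_of_nonneg hβ, abs_of_nonneg hγ]
      rw [h1]
      gcongr
end

section
/- The characteristic function of the circular bivariate Cauchy distribution with density f(x₁,x₂) = (1/(2π)) b/(b²+x₁²+x₂²)^{3/2} equals (α, β) ↦ e^{-b√(α²+β²)}. -/
open MeasureTheory Real

open scoped FourierTransform in
lemma aux_cauchy (b : ℝ) (hb : 0 < b) (r : ℝ) (hr : 0 ≤ r) :
    ∫ x : ℝ, Complex.exp (Complex.I * (r * x)) * ((b / (π * (b ^ 2 + x ^ 2)) : ℝ) : ℂ)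
      = Complex.exp (-(b * r) : ℝ) := by
  have hc : 0 < 2 * π * b := by positivity
  set f : ℝ → ℂ := fun t => Complex.exp (-(2 * π * b * |t|) : ℝ) with hf
  have hcont : Continuous f := by
    rw [hf]; fun_prop
  -- pieces
  have hpos : ∀ w : ℝ, ∀ t ∈ Set.Ioi (0 : ℝ),
      Complex.exp (↑(-2 * π * t * w) * Complex.I) • f t
        = Complex.exp ((-(2 * π * b) - 2 * π * w * Complex.I : ℂ) * t) := by
    intro w t ht
    simp only [hf, smul_eq_mul]
    rw [← Complex.exp_add, abs_of_pos ht]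
    congr 1
    push_cast
    ring
  have hneg : ∀ w : ℝ, ∀ t ∈ Set.Iic (0 : ℝ),
      Complex.exp (↑(-2 * π * t * w) * Complex.I) • f t
        = Complex.exp (((2 * π * b) - 2 * π * w * Complex.I : ℂ) * t) := by
    intro w t ht
    simp only [hf, smul_eq_mul]
    rw [← Complex.exp_add, abs_of_nonpos ht]
    congr 1
    push_cast
    ring
  have re1 : ∀ w : ℝ, (-(2 * π * b) - 2 * π * w * Complex.I : ℂ).re < 0 := by
    intro w; simp; positivity
  have re2 : ∀ w : ℝ, 0 < ((2 * π * b) - 2 * π * w * Complex.I : ℂ).re := by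
    intro w; simp; positivity
  have i1 : ∀ w : ℝ, IntegrableOn
      (fun t : ℝ => Complex.exp (↑(-2 * π * t * w) * Complex.I) • f t) (Set.Ioi 0) := fun w =>
    (integrableOn_congr_fun (hpos w) measurableSet_Ioi).2
      (integrableOn_exp_mul_complex_Ioi (re1 w) 0)
  have i2 : ∀ w : ℝ, IntegrableOn
      (fun t : ℝ => Complex.exp (↑(-2 * π * t * w) * Complex.I) • f t) (Set.Iic 0) := fun w =>
    (integrableOn_congr_fun (hneg w) measurableSet_Iic).2
      (integrableOn_exp_mul_complex_Iic (re2 w) 0)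
  have i3 : Integrable f := by
    have := (i2 0).union (i1 0)
    rw [Set.Iic_union_Ioi, integrableOn_univ] at this
    simpa using this
  have hF : 𝓕 f = fun w : ℝ => ((b / (π * (b ^ 2 + w ^ 2)) : ℝ) : ℂ) := by
    ext w
    rw [Real.fourier_real_eq_integral_exp_smul, ← setIntegral_univ,
      ← Set.Iic_union_Ioi (a := (0 : ℝ)),
      setIntegral_union (Set.Iic_disjoint_Ioi le_rfl) measurableSet_Ioi (i2 w) (i1 w),
      setIntegral_congr_fun measurableSet_Ioi (hpos w),
      setIntegral_congr_fun measurableSet_Iic (hneg w),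
      integral_exp_mul_complex_Ioi (re1 w), integral_exp_mul_complex_Iic (re2 w)]
    have h1 : (-(2 * π * b) - 2 * π * w * Complex.I : ℂ) ≠ 0 := by
      intro h; have := re1 w; rw [h] at this; simp at this
    have h2 : ((2 * π * b) - 2 * π * w * Complex.I : ℂ) ≠ 0 := by
      intro h; have := re2 w; rw [h] at this; simp at this
    have h3 : (π * (b ^ 2 + w ^ 2) : ℂ) ≠ 0 := by
      have : (π * (b ^ 2 + w ^ 2) : ℝ) ≠ 0 := by positivity
      exact_mod_cast this
    push_cast
    simp only [mul_zero, Complex.exp_zero]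
    rw [div_add_div _ _ h2 h1, div_eq_div_iff (mul_ne_zero h2 h1) h3]
    ring_nf
    simp only [Complex.I_sq]
    ring
  have i4 : Integrable (𝓕 f) := by
    rw [hF]
    apply Integrable.ofReal
    have := ProbabilityTheory.integrable_cauchyPDFReal 0 (γ := b.toNNReal)
    refine this.congr (Filter.Eventually.of_forall fun x => ?_)
    change ProbabilityTheory.cauchyPDFReal 0 b.toNNReal x = b / (π * (b ^ 2 + x ^ 2))
    rw [ProbabilityTheory.cauchyPDFReal_def, Real.coe_toNNReal b hb.le, sub_zero, add_comm (x ^ 2)]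
    field_simp
  have key := congrFun (hcont.fourierInv_fourier_eq i3 i4) (r / (2 * π))
  rw [hF, Real.fourierInv_eq'] at key
  have e : f (r / (2 * π)) = Complex.exp (-(b * r) : ℝ) := by
    simp only [hf]
    rw [abs_of_nonneg (by positivity)]
    congr 3
    field_simp
  rw [e] at key
  rw [← key]
  congr 1
  ext x
  rw [smul_eq_mul]
  congr 2
  simp
  have : (π : ℂ) ≠ 0 := by exact_mod_cast pi_ne_zero
  field_simp

lemma aux_integrable (b : ℝ) (hb : 0 < b) :
    Integrable (fun p : ℝ × ℝ => b / (b ^ 2 + p.1 ^ 2 + p.2 ^ 2) ^ ((3 : ℝ) / 2)) := by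
  have h0 : Integrable (fun z : ℂ => ((1 : ℝ) + ‖z‖ ^ 2) ^ (-(3 : ℝ) / 2)) :=
    integrable_rpow_neg_one_add_norm_sq (by rw [Complex.finrank_real_complex]; norm_num)
  rw [← Complex.volume_preserving_equiv_real_prod.integrable_comp_emb
    Complex.measurableEquivRealProd.measurableEmbedding]
  set m := min (b ^ 2) 1 with hm
  have hmpos : 0 < m := by positivity
  refine (h0.const_mul (b * m ^ (-(3 : ℝ) / 2))).mono' ?_ (Filter.Eventually.of_forall fun z => ?_)
  · apply Measurable.aestronglyMeasurable
    apply Measurable.comp _ Complex.measurableEquivRealProd.measurable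
    fun_prop
  · simp only [Function.comp, Complex.measurableEquivRealProd_apply]
    have hz : ‖z‖ ^ 2 = z.re ^ 2 + z.im ^ 2 := by
      rw [Complex.sq_norm, Complex.normSq_apply]; ring
    have hle : m * (1 + ‖z‖ ^ 2) ≤ b ^ 2 + z.re ^ 2 + z.im ^ 2 := by
      have h1 : m ≤ b ^ 2 := min_le_left _ _
      have h2 : m ≤ 1 := min_le_right _ _
      nlinarith [sq_nonneg ‖z‖]
    rw [Real.norm_of_nonneg (by positivity), mul_assoc,
      ← Real.mul_rpow hmpos.le (by positivity), div_eq_mul_inv, ← Real.rpow_neg (by positivity),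
      neg_div]
    exact mul_le_mul_of_nonneg_left
      (Real.rpow_le_rpow_of_nonpos (by positivity) hle (by norm_num)) hb.le

lemma aux_inner (s : ℝ) (hs : 0 < s) :
    ∫ y : ℝ, 1 / (s + y ^ 2) ^ ((3 : ℝ) / 2) = 2 / s := by
  have hd : ∀ y : ℝ, HasDerivAt (fun y => y / (s * √(s + y ^ 2)))
      (1 / (s + y ^ 2) ^ ((3 : ℝ) / 2)) y := by
    intro y
    have hp : 0 < s + y ^ 2 := by positivity
    have h1 : HasDerivAt (fun y : ℝ => s + y ^ 2) (2 * y) y := by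
      simpa using (hasDerivAt_pow 2 y).const_add s
    have h2 := (h1.sqrt hp.ne').const_mul s
    have hq : 0 < √(s + y ^ 2) := by positivity
    have h3 := (hasDerivAt_id y).div h2 (by positivity)
    refine h3.congr_deriv ?_
    have e : (s + y ^ 2) ^ ((3 : ℝ) / 2) = √(s + y ^ 2) ^ 3 := by
      rw [Real.sqrt_eq_rpow, ← Real.rpow_mul_natCast hp.le]; norm_num
    rw [e]
    simp only [id]
    have hsq : √(s + y ^ 2) ^ 2 = s + y ^ 2 := Real.sq_sqrt hp.le
    field_simp
    rw [hsq]; ring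
  have htop : Filter.Tendsto (fun y => y / (s * √(s + y ^ 2))) Filter.atTop (nhds (1 / s)) := by
    have h : Filter.Tendsto (fun y : ℝ => 1 / (s * √(s * (y⁻¹) ^ 2 + 1))) Filter.atTop
        (nhds (1 / (s * √(s * 0 ^ 2 + 1)))) := by
      have h0 : ContinuousAt (fun u : ℝ => 1 / (s * √(s * u ^ 2 + 1))) 0 := by
        apply ContinuousAt.div (by fun_prop) (by fun_prop)
        simp [hs.ne']
      exact h0.tendsto.comp tendsto_inv_atTop_zero
    simp only [ne_eq, OfNat.ofNat_ne_zero, not_false_eq_true, zero_pow, mul_zero, zero_add,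
      Real.sqrt_one, mul_one] at h
    refine h.congr' ?_
    filter_upwards [Filter.eventually_gt_atTop 0] with y hy
    have : √(s + y ^ 2) = y * √(s * (y⁻¹) ^ 2 + 1) := by
      rw [show s + y ^ 2 = y ^ 2 * (s * (y⁻¹) ^ 2 + 1) by field_simp,
        Real.sqrt_mul (by positivity), Real.sqrt_sq hy.le]
    rw [this]
    have : 0 < √(s * (y⁻¹) ^ 2 + 1) := by positivity
    field_simp
  have hbot : Filter.Tendsto (fun y => y / (s * √(s + y ^ 2))) Filter.atBot (nhds (-(1 / s))) := by
    have := (htop.comp Filter.tendsto_neg_atBot_atTop).neg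
    refine this.congr fun y => ?_
    simp [neg_div]
  have hint : Integrable (fun y : ℝ => 1 / (s + y ^ 2) ^ ((3 : ℝ) / 2)) := by
    rw [← integrableOn_univ, ← Set.Iic_union_Ioi (a := (0 : ℝ))]
    have hI : IntegrableOn (fun y : ℝ => 1 / (s + y ^ 2) ^ ((3 : ℝ) / 2)) (Set.Ioi 0) :=
      integrableOn_Ioi_deriv_of_nonneg' (fun x _ => hd x) (fun x _ => by positivity) htop
    refine IntegrableOn.union ?_ hI
    have h2 : IntegrableOn (fun y : ℝ => 1 / (s + y ^ 2) ^ ((3 : ℝ) / 2)) (Set.Ioi (-0)) := by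
      simpa using hI
    have := h2.comp_neg_Iio
    rw [integrableOn_Iic_iff_integrableOn_Iio]
    simpa using this
  rw [integral_of_hasDerivAt_of_tendsto hd hint hbot htop]
  ring

lemma aux_rot (g : ℝ → ℂ) (α β : ℝ) :
    ∫ p : ℝ × ℝ, Complex.exp (Complex.I * (α * p.1 + β * p.2)) * g (p.1 ^ 2 + p.2 ^ 2)
     = ∫ p : ℝ × ℝ, Complex.exp (Complex.I * (√(α ^ 2 + β ^ 2) * p.1)) * g (p.1 ^ 2 + p.2 ^ 2) := by
  set w : ℂ := ⟨α, β⟩ with hw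
  set c : Circle := Circle.exp w.arg with hcdef
  have hr : ‖w‖ = √(α ^ 2 + β ^ 2) := by
    rw [Complex.norm_eq_sqrt_sq_add_sq]
  have hwc : (‖w‖ : ℂ) * c = w := by
    rw [hcdef, Circle.coe_exp]; exact Complex.norm_mul_exp_arg_mul_I w
  have hn : (c : ℂ).re ^ 2 + (c : ℂ).im ^ 2 = 1 := by
    have := Circle.normSq_coe c
    rw [Complex.normSq_apply] at this
    linarith
  have hα : α = ‖w‖ * (c : ℂ).re := by
    have := congrArg Complex.re hwc
    simpa [hw] using this.symm
  have hβ : β = ‖w‖ * (c : ℂ).im := by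
    have := congrArg Complex.im hwc
    simpa [hw] using this.symm
  rw [← Complex.volume_preserving_equiv_real_prod.integral_comp
    Complex.measurableEquivRealProd.measurableEmbedding,
    ← Complex.volume_preserving_equiv_real_prod.integral_comp
    Complex.measurableEquivRealProd.measurableEmbedding,
    ← (rotation c).measurePreserving.integral_comp
      (rotation c).toHomeomorph.measurableEmbedding]
  congr 1
  ext z
  simp only [Complex.measurableEquivRealProd_apply, rotation_apply, Complex.mul_re, Complex.mul_im]
  rw [← hr]
  congr 2
  · congr 1
    have : α * ((c : ℂ).re * z.re - (c : ℂ).im * z.im) + β * ((c : ℂ).re * z.im + (c : ℂ).im * z.re)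
        = ‖w‖ * z.re := by
      linear_combination ((c : ℂ).re * z.re - (c : ℂ).im * z.im) * hα
        + ((c : ℂ).re * z.im + (c : ℂ).im * z.re) * hβ + ‖w‖ * z.re * hn
    exact_mod_cast this
  · linear_combination (z.re ^ 2 + z.im ^ 2) * hn

theorem circular_cauchy_charFun (b : ℝ) (hb : 0 < b) (α β : ℝ) :
    ∫ p : ℝ × ℝ,
        Complex.exp (Complex.I * (α * p.1 + β * p.2)) *
          ((1 / (2 * π)) * (b / (b ^ 2 + p.1 ^ 2 + p.2 ^ 2) ^ ((3 : ℝ) / 2)) : ℝ)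
      = Complex.exp (-(b * Real.sqrt (α ^ 2 + β ^ 2)) : ℝ) := by
  have h := aux_rot (fun q => ((1 / (2 * π)) * (b / (b ^ 2 + q) ^ ((3 : ℝ) / 2)) : ℝ)) α β
  simp only [← add_assoc] at h
  rw [h, ← aux_cauchy b hb _ (Real.sqrt_nonneg _)]
  have hi : Integrable (fun p : ℝ × ℝ =>
      Complex.exp (Complex.I * (√(α ^ 2 + β ^ 2) * p.1)) *
        (((1 / (2 * π)) * (b / (b ^ 2 + p.1 ^ 2 + p.2 ^ 2) ^ ((3 : ℝ) / 2)) : ℝ) : ℂ)) := by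
    have h1 := (((aux_integrable b hb).const_mul (1 / (2 * π))).ofReal (𝕜 := ℂ))
    refine h1.bdd_mul (c := 1) (by fun_prop) (Filter.Eventually.of_forall fun p => ?_)
    rw [mul_comm, ← Complex.ofReal_mul, Complex.norm_exp_ofReal_mul_I]
  rw [Measure.volume_eq_prod] at hi ⊢
  rw [integral_prod _ hi]
  congr 1
  ext x
  simp only
  rw [integral_const_mul, integral_complex_ofReal]
  congr 2
  have : ∀ y : ℝ, 1 / (2 * π) * (b / (b ^ 2 + x ^ 2 + y ^ 2) ^ ((3 : ℝ) / 2))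
      = (b / (2 * π)) * (1 / ((b ^ 2 + x ^ 2) + y ^ 2) ^ ((3 : ℝ) / 2)) := by
    intro y; ring
  simp_rw [this]
  rw [integral_const_mul, aux_inner _ (by positivity)]
  field_simp
end

section
/- For a, c > 0, ∫₀^∞ J₀(cr)/(r² + a²) dr = (π/(2a)) (I₀(ac) − L₀(ac)), where I₀ is the modified Bessel function of the first kind and L₀ the modified Struve function of order 0. -/
open MeasureTheory Real

/-- Modified Bessel function of the first kind of order 0. -/
noncomputable def besselI0 (x : ℝ) : ℝ :=
  ∑' m : ℕ, (x / 2) ^ (2 * m) / ((m.factorial : ℝ)) ^ 2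

/-- Modified Struve function of order 0. -/
noncomputable def struveL0 (x : ℝ) : ℝ :=
  (x / 2) * ∑' k : ℕ, (x / 2) ^ (2 * k) / (Real.Gamma (3 / 2 + k)) ^ 2


open Set Filter Topology FourierTransform

theorem wallis_even (n : ℕ) : (∫ x in (0:ℝ)..π, sin x ^ (2 * n)) =
    π * ((2 * n).factorial / (4 ^ n * (n.factorial : ℝ) ^ 2)) := by
  rw [integral_sin_pow_even]
  congr 1
  induction n with
  | zero => simp
  | succ k ih =>
    rw [Finset.prod_range_succ, ih, show 2 * (k + 1) = 2 * k + 1 + 1 by ring]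
    simp only [Nat.factorial_succ]
    push_cast
    have := Nat.factorial_ne_zero k
    field_simp
    ring

theorem wallis_odd (n : ℕ) : (∫ x in (0:ℝ)..π, sin x ^ (2 * n + 1)) =
    π * ((2 * n + 1).factorial / (2 ^ (2 * n + 1) * (Real.Gamma (3 / 2 + n)) ^ 2)) := by
  rw [integral_sin_pow_odd]
  induction n with
  | zero =>
    have h : Real.Gamma (3 / 2) = √π / 2 := by
      rw [show (3 / 2 : ℝ) = 1 / 2 + 1 by norm_num, Real.Gamma_add_one (by norm_num),
        Real.Gamma_one_half_eq]
      ring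
    have : π ≠ 0 := Real.pi_ne_zero
    simp [h, div_pow, Real.sq_sqrt Real.pi_pos.le]
    field_simp
  | succ k ih =>
    have hG : Real.Gamma (3 / 2 + (k : ℝ)) ≠ 0 := (Real.Gamma_pos_of_pos (by positivity)).ne'
    have h : Real.Gamma (3 / 2 + ((k + 1 : ℕ) : ℝ)) = (3 / 2 + k) * Real.Gamma (3 / 2 + k) := by
      rw [← Real.Gamma_add_one (by positivity)]
      congr 1
      push_cast
      ring
    rw [Finset.prod_range_succ, ← mul_assoc, ih, h,
      show 2 * (k + 1) + 1 = 2 * k + 1 + 1 + 1 by ring]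
    simp only [Nat.factorial_succ]
    push_cast
    have : (3 / 2 + (k : ℝ)) ≠ 0 := by positivity
    field_simp
    ring

theorem hasSum_integral_sin (u : ℕ → ℝ) (p : ℕ → ℕ) (g : ℝ → ℝ) (hu : Summable fun n => ‖u n‖)
    (h : ∀ t, HasSum (fun n => u n * sin t ^ p n) (g t)) :
    HasSum (fun n => u n * ∫ t in (0:ℝ)..π, sin t ^ p n) (∫ t in (0:ℝ)..π, g t) := by
  simp_rw [← intervalIntegral.integral_const_mul]
  apply intervalIntegral.hasSum_integral_of_dominated_convergence (fun n _ => ‖u n‖)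
  · intro n
    apply Continuous.aestronglyMeasurable
    fun_prop
  · intro n
    refine Eventually.of_forall fun t _ => ?_
    rw [norm_mul, norm_pow]
    exact mul_le_of_le_one_right (norm_nonneg _)
      (pow_le_one₀ (norm_nonneg _) (abs_sin_le_one t))
  · exact Eventually.of_forall fun t _ => hu
  · simp
  · exact Eventually.of_forall fun t _ => h t

theorem besselI0_integral (x : ℝ) : π * besselI0 x = ∫ t in (0:ℝ)..π, cosh (x * sin t) := by
  have := hasSum_integral_sin (fun n => x ^ (2 * n) / (2 * n).factorial) (fun n => 2 * n)
    (fun t => cosh (x * sin t)) (Real.hasSum_cosh x).summable.norm (fun t => by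
      convert Real.hasSum_cosh (x * sin t) using 2
      ring)
  rw [← this.tsum_eq, besselI0, ← tsum_mul_left]
  congr 1
  ext n
  rw [wallis_even]
  have : ((2 * n).factorial : ℝ) ≠ 0 := by exact_mod_cast Nat.factorial_ne_zero _
  rw [div_pow, pow_mul 2 2]
  norm_num
  field_simp

theorem struveL0_integral (x : ℝ) : π * struveL0 x = ∫ t in (0:ℝ)..π, sinh (x * sin t) := by
  have := hasSum_integral_sin (fun n => x ^ (2 * n + 1) / (2 * n + 1).factorial)
    (fun n => 2 * n + 1)
    (fun t => sinh (x * sin t)) (Real.hasSum_sinh x).summable.norm (fun t => by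
      convert Real.hasSum_sinh (x * sin t) using 2
      ring)
  rw [← this.tsum_eq, struveL0, ← tsum_mul_left, ← tsum_mul_left]
  congr 1
  ext n
  rw [wallis_odd]
  have : ((2 * n + 1).factorial : ℝ) ≠ 0 := by exact_mod_cast Nat.factorial_ne_zero _
  have hG : Real.Gamma (3 / 2 + (n : ℝ)) ≠ 0 := (Real.Gamma_pos_of_pos (by positivity)).ne'
  rw [div_pow]
  field_simp
  ring

theorem besselJ0_integral (x : ℝ) : π * besselJ 0 x = ∫ t in (0:ℝ)..π, cos (x * sin t) := by
  have := hasSum_integral_sin (fun n => (-1) ^ n * x ^ (2 * n) / (2 * n).factorial)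
    (fun n => 2 * n)
    (fun t => cos (x * sin t)) (Real.hasSum_cos x).summable.norm (fun t => by
      convert Real.hasSum_cos (x * sin t) using 2
      ring)
  rw [← this.tsum_eq, besselJ, ← tsum_mul_left]
  congr 1
  ext n
  have e : (2 * (n : ℝ) + 0) = ((2 * n : ℕ) : ℝ) := by push_cast; ring
  rw [wallis_even, add_zero, Real.Gamma_nat_eq_factorial, e, Real.rpow_natCast]
  have : ((2 * n).factorial : ℝ) ≠ 0 := by exact_mod_cast Nat.factorial_ne_zero _
  rw [div_pow, pow_mul 2 2]
  norm_num
  field_simp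

theorem integrable_inv_sq_add (a : ℝ) (ha : 0 < a) :
    Integrable fun r : ℝ => 1 / (r ^ 2 + a ^ 2) := by
  have h := (integrable_inv_one_add_sq.comp_div ha.ne').mul_const ((a ^ 2)⁻¹)
  refine h.congr (Eventually.of_forall fun r => ?_)
  simp only
  field_simp
  ring

/-- the exponential kernel -/
noncomputable def expAbs (a : ℝ) (x : ℝ) : ℂ := Complex.exp (-(2 * π * a * |x| : ℝ))

theorem expAbs_Ioi (a w x : ℝ) (hx : x ∈ Ioi (0:ℝ)) :
    Complex.exp (↑(-2 * π * x * w) * Complex.I) • expAbs a x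
      = Complex.exp ((-(2 * π * a) - 2 * π * w * Complex.I) * x) := by
  rw [expAbs, smul_eq_mul, ← Complex.exp_add, abs_of_pos hx]
  congr 1
  push_cast
  ring

theorem expAbs_Iic (a w x : ℝ) (hx : x ∈ Iic (0:ℝ)) :
    Complex.exp (↑(-2 * π * x * w) * Complex.I) • expAbs a x
      = Complex.exp ((2 * π * a - 2 * π * w * Complex.I) * x) := by
  rw [expAbs, smul_eq_mul, ← Complex.exp_add, abs_of_nonpos hx]
  congr 1
  push_cast
  ring

theorem expAbs_intOn_Ioi (a w : ℝ) (ha : 0 < a) :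
    IntegrableOn (fun x : ℝ => Complex.exp (↑(-2 * π * x * w) * Complex.I) • expAbs a x)
      (Ioi 0) := by
  rw [integrableOn_congr_fun (expAbs_Ioi a w) measurableSet_Ioi]
  apply integrableOn_exp_mul_complex_Ioi
  simp
  positivity

theorem expAbs_intOn_Iic (a w : ℝ) (ha : 0 < a) :
    IntegrableOn (fun x : ℝ => Complex.exp (↑(-2 * π * x * w) * Complex.I) • expAbs a x)
      (Iic 0) := by
  rw [integrableOn_congr_fun (expAbs_Iic a w) measurableSet_Iic]
  apply integrableOn_exp_mul_complex_Iic
  simp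
  positivity

theorem integrable_expAbs (a : ℝ) (ha : 0 < a) : Integrable (expAbs a) := by
  rw [← integrableOn_univ, ← Iic_union_Ioi (a := (0:ℝ))]
  have h1 := expAbs_intOn_Iic a 0 ha
  have h2 := expAbs_intOn_Ioi a 0 ha
  simp only [mul_zero, Complex.ofReal_zero, zero_mul, Complex.exp_zero, one_smul] at h1 h2
  exact h1.union h2

theorem fourier_expAbs (a : ℝ) (ha : 0 < a) :
    𝓕 (expAbs a) = fun w : ℝ => ((a / π * (1 / (w ^ 2 + a ^ 2)) : ℝ) : ℂ) := by
  ext w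
  rw [Real.fourier_real_eq_integral_exp_smul, ← intervalIntegral.integral_Iic_add_Ioi
    (expAbs_intOn_Iic a w ha) (expAbs_intOn_Ioi a w ha),
    setIntegral_congr_fun measurableSet_Iic (expAbs_Iic a w),
    setIntegral_congr_fun measurableSet_Ioi (expAbs_Ioi a w),
    integral_exp_mul_complex_Iic (by simp; positivity),
    integral_exp_mul_complex_Ioi (by simp; positivity)]
  have hp : (π : ℂ) ≠ 0 := by exact_mod_cast Real.pi_ne_zero
  have h1 : (a - w * Complex.I : ℂ) ≠ 0 := by
    intro h
    have := congrArg Complex.re h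
    simp at this
    exact ha.ne' this
  have h2 : (a + w * Complex.I : ℂ) ≠ 0 := by
    intro h
    have := congrArg Complex.re h
    simp at this
    exact ha.ne' this
  have h3 : (w ^ 2 + a ^ 2 : ℂ) = (a - w * Complex.I) * (a + w * Complex.I) := by
    ring_nf
    simp
  have e1 : (2 * π * a - 2 * π * w * Complex.I : ℂ) = 2 * π * (a - w * Complex.I) := by ring
  have e2 : (-(2 * π * a) - 2 * π * w * Complex.I : ℂ) = - (2 * π * (a + w * Complex.I)) := by ring
  push_cast
  rw [h3, e1, e2]
  simp only [mul_zero, Complex.exp_zero, neg_div_neg_eq]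
  field_simp
  ring

theorem integral_cos_div (a b : ℝ) (ha : 0 < a) (hb : 0 ≤ b) :
    ∫ r in Ioi (0:ℝ), cos (b * r) / (r ^ 2 + a ^ 2) = π / (2 * a) * rexp (-(a * b)) := by
  have hint : Integrable (𝓕 (expAbs a)) := by
    rw [fourier_expAbs a ha]
    exact ((integrable_inv_sq_add a ha).const_mul _).ofReal
  have hcont : Continuous (expAbs a) := by
    unfold expAbs
    fun_prop
  have h := (integrable_expAbs a ha).fourierInv_fourier_eq hint
    (hcont.continuousAt (x := b / (2 * π)))
  rw [Real.fourierInv_eq', fourier_expAbs a ha] at h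
  have h' := congrArg Complex.re h
  rw [← RCLike.re_eq_complex_re, ← integral_re] at h'
  · have e : ∀ v : ℝ, RCLike.re (Complex.exp (↑(2 * π * inner ℝ v (b / (2 * π))) * Complex.I) •
        ((a / π * (1 / (v ^ 2 + a ^ 2)) : ℝ) : ℂ))
        = a / π * ((fun r => cos (b * r) / (r ^ 2 + a ^ 2)) |v|) := by
      intro v
      have e3 : 2 * π * inner ℝ v (b / (2 * π)) = b * v := by
        simp
        field_simp
      have e4 : cos (b * |v|) = cos (b * v) := by
        rw [← Real.cos_abs (b * v), abs_mul, abs_of_nonneg hb]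
      rw [e3]
      simp only [e4, sq_abs]
      rw [smul_eq_mul, RCLike.re_eq_complex_re, Complex.re_mul_ofReal, Complex.exp_ofReal_mul_I_re]
      ring
    simp_rw [e] at h'
    rw [integral_const_mul,
      integral_comp_abs (f := fun r => cos (b * r) / (r ^ 2 + a ^ 2))] at h'
    have e5 : RCLike.re (expAbs a (b / (2 * π))) = rexp (-(a * b)) := by
      rw [expAbs, RCLike.re_eq_complex_re, ← Complex.ofReal_neg, Complex.exp_ofReal_re]
      rw [abs_of_nonneg (by positivity)]
      congr 1
      field_simp
    rw [e5] at h'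
    rw [← h']
    field_simp
  · rw [fourier_expAbs a ha] at hint
    refine hint.norm.mono' ?_ (Eventually.of_forall fun v => ?_)
    · have hc : Continuous fun v : ℝ =>
          Complex.exp (↑(2 * π * inner ℝ v (b / (2 * π))) * Complex.I) := by fun_prop
      exact hc.aestronglyMeasurable.smul hint.aestronglyMeasurable
    · rw [norm_smul, Complex.norm_exp_ofReal_mul_I, one_mul]

theorem integral_besselJ0_div (a c : ℝ) (ha : 0 < a) (hc : 0 < c) :
    ∫ r in Set.Ioi (0 : ℝ), besselJ 0 (c * r) / (r ^ 2 + a ^ 2)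
      = (π / (2 * a)) * (besselI0 (a * c) - struveL0 (a * c)) := by
  apply mul_left_cancel₀ Real.pi_ne_zero
  have hR : π * ((π / (2 * a)) * (besselI0 (a * c) - struveL0 (a * c)))
      = π / (2 * a) * ∫ t in (0:ℝ)..π, rexp (-(a * (c * sin t))) := by
    rw [mul_left_comm, mul_sub, besselI0_integral, struveL0_integral, ← intervalIntegral.integral_sub]
    · congr 2
      ext t
      rw [Real.cosh_sub_sinh, mul_assoc]
    · apply Continuous.intervalIntegrable
      fun_prop
    · apply Continuous.intervalIntegrable
      fun_prop
  rw [hR, ← integral_const_mul, ← intervalIntegral.integral_const_mul]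
  have h1 : ∀ r : ℝ, π * (besselJ 0 (c * r) / (r ^ 2 + a ^ 2))
      = ∫ t in (0:ℝ)..π, cos (c * sin t * r) / (r ^ 2 + a ^ 2) := by
    intro r
    rw [intervalIntegral.integral_div, ← mul_div_assoc, besselJ0_integral]
    congr 2
    ext t
    congr 1
    ring
  simp_rw [h1]
  rw [← intervalIntegral_integral_swap (f := fun t r => cos (c * sin t * r) / (r ^ 2 + a ^ 2))]
  · apply intervalIntegral.integral_congr
    intro t ht
    rw [uIcc_of_le Real.pi_pos.le] at ht
    exact integral_cos_div a (c * sin t) ha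
      (mul_nonneg hc.le (Real.sin_nonneg_of_nonneg_of_le_pi ht.1 ht.2))
  · have hd : Integrable (fun z : ℝ × ℝ => (1:ℝ) * (1 / (z.2 ^ 2 + a ^ 2)))
        ((volume.restrict (uIoc 0 π)).prod (volume.restrict (Ioi (0:ℝ)))) :=
      Integrable.mul_prod (f := fun _ : ℝ => (1:ℝ)) (g := fun r : ℝ => 1 / (r ^ 2 + a ^ 2))
        (by
          rw [uIoc_of_le Real.pi_pos.le]
          exact integrableOn_const (by simp))
        (integrable_inv_sq_add a ha).integrableOn
    refine hd.mono' ?_ (Eventually.of_forall fun z => ?_)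
    · apply Continuous.aestronglyMeasurable
      unfold Function.uncurry
      apply Continuous.div (by fun_prop) (by fun_prop)
      intro z
      positivity
    · have : 0 < z.2 ^ 2 + a ^ 2 := by positivity
      simp only [Function.uncurry, norm_div, one_mul, Real.norm_eq_abs, abs_of_pos this]
      gcongr
      exact Real.abs_cos_le_one _
end

section
/- Let φ_n(α,β) be the characteristic function of ((R_n+Δ₁⁽ⁿ⁾)cos θ, (R_n+Δ₂⁽ⁿ⁾)sin θ) where R_n ~ Exp(μ√n/t), Δ_i⁽ⁿ⁾ = C_i/√n, θ uniform on [0,2π) independent of R_n. Then for every fixed (α,β), [φ_n(α,β)]^n → exp(−(α²/2)(t²/μ² + C₁t/μ + C₁²/2) − (β²/2)(t²/μ² + C₂t/μ + C₂²/2)) as n → ∞. -/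
open MeasureTheory Real Filter

/-- The characteristic function of `((R_n + Δ₁⁽ⁿ⁾) cos θ, (R_n + Δ₂⁽ⁿ⁾) sin θ)`, where
`θ` is uniform on `[0, 2π)` independent of `R_n ~ Exp(μ√n/t)` and `Δᵢ⁽ⁿ⁾ = Cᵢ/√n`,
written out as an integral against the joint law. -/
noncomputable def φ (μ t C₁ C₂ : ℝ) (n : ℕ) (α β : ℝ) : ℂ :=
  (2 * π : ℝ)⁻¹ *
    ∫ θ in (0 : ℝ)..(2 * π), ∫ r in Set.Ioi (0 : ℝ),
      Complex.exp (Complex.I *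
          (α * ((r + C₁ / Real.sqrt n) * Real.cos θ) +
           β * ((r + C₂ / Real.sqrt n) * Real.sin θ))) *
        ((μ * Real.sqrt n / t) * Real.exp (-(μ * Real.sqrt n / t) * r) : ℝ)

lemma aux_inner_s17 (b c l : ℝ) (hl : 0 < l) (F : ℝ → ℂ)
    (hF : ∀ r, F r = Complex.exp (Complex.I * c) * (l * Complex.exp ((-l + Complex.I * b) * r))) :
    ∫ r in Set.Ioi (0 : ℝ), F r
      = Complex.exp (Complex.I * c) / (1 - Complex.I * ((b / l : ℝ) : ℂ)) := by
  simp_rw [hF]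
  rw [integral_const_mul, integral_const_mul, integral_exp_mul_complex_Ioi (by simpa using hl)]
  have hl' : (l : ℂ) ≠ 0 := by exact_mod_cast hl.ne'
  have h1 : (-l + Complex.I * b : ℂ) ≠ 0 := by
    intro h
    have := congrArg Complex.re h
    simp at this
    exact hl.ne' this
  have h2 : (1 - Complex.I * ((b / l : ℝ) : ℂ)) ≠ 0 := by
    intro h
    have := congrArg Complex.re h
    simp at this
  rw [div_eq_mul_inv, Complex.ofReal_zero, mul_zero, Complex.exp_zero]
  congr 1
  apply eq_inv_of_mul_eq_one_left
  push_cast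
  field_simp
  ring

lemma aux_norm (x : ℝ) : 1 ≤ ‖(1 - Complex.I * (x : ℂ))‖ := by
  have := Complex.abs_re_le_norm (1 - Complex.I * (x : ℂ))
  simpa using this

lemma aux_ne (x : ℝ) : (1 - Complex.I * (x : ℂ)) ≠ 0 := by
  have := aux_norm x
  intro h
  rw [h] at this
  norm_num at this

lemma aux_trig (P Q R : ℝ) :
    ∫ θ in (0:ℝ)..(2 * π), (P * cos θ ^ 2 + Q * (sin θ * cos θ) + R * sin θ ^ 2) = π * (P + R) := by
  rw [intervalIntegral.integral_add, intervalIntegral.integral_add,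
    intervalIntegral.integral_const_mul, intervalIntegral.integral_const_mul,
    intervalIntegral.integral_const_mul, integral_cos_sq, integral_sin_sq, integral_sin_mul_cos₁]
  · simp; ring
  all_goals exact Continuous.intervalIntegrable (by fun_prop) _ _

lemma aux_lin (P R : ℝ) :
    ∫ θ in (0:ℝ)..(2 * π), (P * cos θ + R * sin θ) = 0 := by
  rw [intervalIntegral.integral_add,
    intervalIntegral.integral_const_mul, intervalIntegral.integral_const_mul]
  · simp
  all_goals exact Continuous.intervalIntegrable (by fun_prop) _ _

lemma aux_point (d : ℝ) : Tendsto (fun n : ℕ => (n : ℂ) *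
    (Complex.exp (Complex.I * ((d / √n : ℝ) : ℂ)) - 1 - Complex.I * ((d / √n : ℝ) : ℂ)))
    atTop (nhds (-(d ^ 2 / 2 : ℝ) : ℂ)) := by
  rw [tendsto_iff_norm_sub_tendsto_zero]
  have hs : Tendsto (fun n : ℕ => √(n:ℝ)) atTop atTop :=
    Real.tendsto_sqrt_atTop.comp tendsto_natCast_atTop_atTop
  have h0 : Tendsto (fun n : ℕ => |d| ^ 3 / √(n:ℝ)) atTop (nhds 0) := hs.const_div_atTop _
  refine squeeze_zero' (Eventually.of_forall fun _ => norm_nonneg _) ?_ h0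
  filter_upwards [hs.eventually_ge_atTop (|d| + 1)] with n hn
  have hpos : 0 < √(n:ℝ) := by have := abs_nonneg d; linarith
  have hsq : √(n:ℝ) ^ 2 = n := Real.sq_sqrt (Nat.cast_nonneg n)
  set s := √(n:ℝ)
  have hz : ‖Complex.I * ((d / s : ℝ) : ℂ)‖ = |d| / s := by
    rw [norm_mul, Complex.norm_I, one_mul, Complex.norm_real, Real.norm_eq_abs, abs_div,
      abs_of_pos hpos]
  have hb := Complex.exp_bound (x := Complex.I * ((d / s : ℝ) : ℂ))
    (by rw [hz, div_le_one hpos]; linarith) (n := 3) (by norm_num)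
  rw [hz] at hb
  have hnc : (n : ℂ) = (s : ℂ) ^ 2 := by rw [← Complex.ofReal_pow, hsq]; simp
  have hsc : (s : ℂ) ≠ 0 := by exact_mod_cast hpos.ne'
  have heq : (n : ℂ) * (Complex.exp (Complex.I * ((d / s : ℝ) : ℂ)) - 1
      - Complex.I * ((d / s : ℝ) : ℂ)) - (-(d ^ 2 / 2 : ℝ) : ℂ) = (n : ℂ) *
      (Complex.exp (Complex.I * ((d / s : ℝ) : ℂ)) - ∑ m ∈ Finset.range 3,
        (Complex.I * ((d / s : ℝ) : ℂ)) ^ m / m.factorial) := by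
    simp only [Finset.sum_range_succ, Finset.sum_range_zero, Nat.factorial, mul_pow, Complex.I_sq]
    rw [hnc]
    push_cast
    field_simp
    ring
  rw [heq, norm_mul, Complex.norm_natCast, ← hsq]
  calc s ^ 2 * _ ≤ s ^ 2 * _ := mul_le_mul_of_nonneg_left hb (by positivity)
    _ = |d| ^ 3 / s * (4 / 18) := by
      norm_num [Nat.factorial]
      field_simp
    _ ≤ |d| ^ 3 / s * 1 := by gcongr; norm_num
    _ = _ := mul_one _

lemma aux_trig_bound (a b θ : ℝ) : |a * cos θ + b * sin θ| ≤ |a| + |b| := by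
  calc _ ≤ |a * cos θ| + |b * sin θ| := abs_add_le _ _
    _ = |a| * |cos θ| + |b| * |sin θ| := by rw [abs_mul, abs_mul]
    _ ≤ |a| * 1 + |b| * 1 := by gcongr; exacts [abs_cos_le_one θ, abs_sin_le_one θ]
    _ = _ := by ring

/-- the integrand after removing the linear part -/
noncomputable def auxH (d e : ℝ → ℝ) (n : ℕ) (θ : ℝ) : ℂ :=
  ((n : ℂ) * (Complex.exp (Complex.I * ((d θ / √n : ℝ) : ℂ)) - 1 -
    Complex.I * ((d θ / √n : ℝ) : ℂ)) - ((d θ * e θ + e θ ^ 2 : ℝ) : ℂ)) /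
    (1 - Complex.I * ((e θ / √n : ℝ) : ℂ))

lemma auxH_eq (d e : ℝ → ℝ) (n : ℕ) (hn : 0 < n) (θ : ℝ) :
    auxH d e n θ = n * (Complex.exp (Complex.I * ((d θ / √n : ℝ) : ℂ)) /
      (1 - Complex.I * ((e θ / √n : ℝ) : ℂ)) - 1)
      - (√n : ℝ) * Complex.I * ((d θ + e θ : ℝ) : ℂ) := by
  have hpos : 0 < √(n:ℝ) := by positivity
  have hsq : √(n:ℝ) ^ 2 = n := Real.sq_sqrt (Nat.cast_nonneg n)
  have h2 := aux_ne (e θ / √n)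
  unfold auxH
  set s := √(n:ℝ)
  have hnc : (n : ℂ) = (s : ℂ) ^ 2 := by rw [← Complex.ofReal_pow, hsq]; simp
  have hsc : (s : ℂ) ≠ 0 := by exact_mod_cast hpos.ne'
  rw [div_eq_iff h2, sub_mul, mul_assoc, sub_mul, div_mul_cancel₀ _ h2, hnc]
  generalize Complex.exp (Complex.I * ((d θ / s : ℝ) : ℂ)) = E
  push_cast
  field_simp
  ring_nf
  simp only [Complex.I_sq]
  ring

lemma auxH_tendsto (d e : ℝ → ℝ) (θ : ℝ) : Tendsto (fun n : ℕ => auxH d e n θ) atTop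
    (nhds ((-(d θ ^ 2 / 2 + d θ * e θ + e θ ^ 2) : ℝ) : ℂ)) := by
  have hs : Tendsto (fun n : ℕ => √(n:ℝ)) atTop atTop :=
    Real.tendsto_sqrt_atTop.comp tendsto_natCast_atTop_atTop
  have h0 : Tendsto (fun n : ℕ => e θ / √(n:ℝ)) atTop (nhds 0) := hs.const_div_atTop _
  have h1 : Tendsto (fun n : ℕ => (1 - Complex.I * ((e θ / √(n:ℝ) : ℝ) : ℂ))) atTop (nhds 1) := by
    have := ((Complex.continuous_ofReal.tendsto 0).comp h0).const_mul Complex.I |>.const_sub 1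
    simpa using this
  have := ((aux_point (d θ)).sub_const ((d θ * e θ + e θ ^ 2 : ℝ) : ℂ)).div h1 one_ne_zero
  unfold auxH
  refine (this.congr fun n => rfl).trans (le_of_eq ?_)
  congr 1
  push_cast
  ring

lemma auxH_bound (d e : ℝ → ℝ) (D E : ℝ) (hd : ∀ θ, |d θ| ≤ D) (he : ∀ θ, |e θ| ≤ E) (n : ℕ)
    (hn : 0 < n) (hD : D ≤ √n) (θ : ℝ) : ‖auxH d e n θ‖ ≤ D ^ 2 + (D * E + E ^ 2) := by
  have hpos : 0 < √(n:ℝ) := by positivity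
  have hsq : √(n:ℝ) ^ 2 = n := Real.sq_sqrt (Nat.cast_nonneg n)
  have h2 := aux_norm (e θ / √n)
  have hD0 : 0 ≤ D := (abs_nonneg _).trans (hd θ)
  have hz : ‖Complex.I * ((d θ / √n : ℝ) : ℂ)‖ = |d θ| / √n := by
    rw [norm_mul, Complex.norm_I, one_mul, Complex.norm_real, Real.norm_eq_abs, abs_div,
      abs_of_pos hpos]
  have hb := Complex.norm_exp_sub_one_sub_id_le (x := Complex.I * ((d θ / √n : ℝ) : ℂ))
    (by rw [hz, div_le_one hpos]; exact (hd θ).trans hD)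
  rw [hz] at hb
  unfold auxH
  rw [norm_div]
  refine (div_le_self (norm_nonneg _) h2).trans ((norm_sub_le _ _).trans ?_)
  gcongr
  · rw [norm_mul, Complex.norm_natCast]
    calc (n:ℝ) * _ ≤ n * (|d θ| / √n) ^ 2 := by gcongr
      _ = |d θ| ^ 2 := by rw [div_pow, hsq]; field_simp
      _ ≤ D ^ 2 := by gcongr; exact hd θ
  · rw [Complex.norm_real, Real.norm_eq_abs]
    refine (abs_add_le _ _).trans ?_
    rw [abs_mul, abs_pow]
    gcongr
    exacts [hd θ, he θ, he θ]

lemma auxH_cont (d e : ℝ → ℝ) (hd : Continuous d) (he : Continuous e) (n : ℕ) :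
    Continuous (auxH d e n) := by
  unfold auxH
  refine Continuous.div (by fun_prop) (by fun_prop) fun θ => aux_ne _

theorem gaussian_limit_theorem (μ t C₁ C₂ : ℝ) (hμ : 0 < μ) (ht : 0 < t)
    (hC₁ : 0 < C₁) (hC₂ : 0 < C₂) (α β : ℝ) :
    Tendsto (fun n : ℕ => (φ μ t C₁ C₂ n α β) ^ n) atTop
      (nhds (Complex.exp (-(α ^ 2 / 2 * (t ^ 2 / μ ^ 2 + C₁ * t / μ + C₁ ^ 2 / 2)
          + β ^ 2 / 2 * (t ^ 2 / μ ^ 2 + C₂ * t / μ + C₂ ^ 2 / 2)) : ℝ))) := by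
  set d : ℝ → ℝ := fun θ => (α * C₁) * cos θ + (β * C₂) * sin θ with hd
  set e : ℝ → ℝ := fun θ => (α * t / μ) * cos θ + (β * t / μ) * sin θ with he
  have hdc : Continuous d := by fun_prop
  have hec : Continuous e := by fun_prop
  have hs : Tendsto (fun n : ℕ => √(n:ℝ)) atTop atTop :=
    Real.tendsto_sqrt_atTop.comp tendsto_natCast_atTop_atTop
  have hφ : ∀ n : ℕ, 0 < n → φ μ t C₁ C₂ n α β = (2 * π : ℝ)⁻¹ * ∫ θ in (0 : ℝ)..(2 * π),
      Complex.exp (Complex.I * ((d θ / √n : ℝ) : ℂ)) /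
      (1 - Complex.I * ((e θ / √n : ℝ) : ℂ)) := by
    intro n hn
    have hpos : 0 < √(n:ℝ) := by positivity
    unfold φ
    congr 1
    refine intervalIntegral.integral_congr fun θ _ => ?_
    beta_reduce
    rw [aux_inner_s17 (α * cos θ + β * sin θ) (d θ / √n) (μ * √n / t) (by positivity)]
    · congr 4
      simp only [he]
      field_simp
    · intro r
      rw [Complex.ofReal_mul, Complex.ofReal_exp, mul_left_comm, ← Complex.exp_add,
        mul_left_comm (Complex.exp (Complex.I * ((d θ / √n : ℝ) : ℂ))),
        ← Complex.exp_add]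
      congr 2
      simp only [hd]
      push_cast
      ring
  have hint : Tendsto (fun n : ℕ => ∫ θ in (0 : ℝ)..(2 * π), auxH d e n θ) atTop
      (nhds (∫ θ in (0 : ℝ)..(2 * π), ((-(d θ ^ 2 / 2 + d θ * e θ + e θ ^ 2) : ℝ) : ℂ))) := by
    refine intervalIntegral.tendsto_integral_filter_of_dominated_convergence
      (fun _ => (|α * C₁| + |β * C₂|) ^ 2 + ((|α * C₁| + |β * C₂|) * (|α * t / μ| + |β * t / μ|)
        + (|α * t / μ| + |β * t / μ|) ^ 2)) ?_ ?_ ?_ ?_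
    · exact Eventually.of_forall fun n => (auxH_cont d e hdc hec n).aestronglyMeasurable
    · filter_upwards [hs.eventually_ge_atTop (|α * C₁| + |β * C₂|), eventually_gt_atTop 0]
        with n hn hn0
      exact Eventually.of_forall fun θ _ => auxH_bound d e _ _ (fun θ => aux_trig_bound _ _ θ)
        (fun θ => aux_trig_bound _ _ θ) n hn0 hn θ
    · exact intervalIntegrable_const
    · exact Eventually.of_forall fun θ _ => auxH_tendsto d e θ
  have hval : ∫ θ in (0 : ℝ)..(2 * π), ((-(d θ ^ 2 / 2 + d θ * e θ + e θ ^ 2) : ℝ) : ℂ) =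
      ((2 * π : ℝ) : ℂ) * ((-(α ^ 2 / 2 * (t ^ 2 / μ ^ 2 + C₁ * t / μ + C₁ ^ 2 / 2)
          + β ^ 2 / 2 * (t ^ 2 / μ ^ 2 + C₂ * t / μ + C₂ ^ 2 / 2)) : ℝ) : ℂ) := by
    rw [intervalIntegral.integral_ofReal, ← Complex.ofReal_mul]
    congr 1
    have := aux_trig (-((α * C₁) ^ 2 / 2 + (α * C₁) * (α * t / μ) + (α * t / μ) ^ 2))
      (-((α * C₁) * (β * C₂) + (α * C₁) * (β * t / μ) + (β * C₂) * (α * t / μ)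
        + 2 * (α * t / μ) * (β * t / μ)))
      (-((β * C₂) ^ 2 / 2 + (β * C₂) * (β * t / μ) + (β * t / μ) ^ 2))
    refine Eq.trans ?_ (this.trans ?_)
    · refine intervalIntegral.integral_congr fun θ _ => ?_
      simp only [hd, he]
      ring
    · field_simp
      ring
  have hπ : ((2 * π : ℝ) : ℂ) ≠ 0 := by exact_mod_cast (by positivity : (2 * π : ℝ) ≠ 0)
  have hlin : ∫ θ in (0 : ℝ)..(2 * π), ((d θ + e θ : ℝ) : ℂ) = 0 := by
    rw [intervalIntegral.integral_ofReal]
    have := aux_lin (α * C₁ + α * t / μ) (β * C₂ + β * t / μ)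
    rw [Complex.ofReal_eq_zero]
    refine Eq.trans ?_ this
    refine intervalIntegral.integral_congr fun θ _ => ?_
    simp only [hd, he]
    ring
  have hmul : ∀ n : ℕ, 0 < n → (n : ℂ) * (φ μ t C₁ C₂ n α β - 1) =
      ((2 * π : ℝ) : ℂ)⁻¹ * ∫ θ in (0 : ℝ)..(2 * π), auxH d e n θ := by
    intro n hn
    rw [hφ n hn]
    simp_rw [auxH_eq d e n hn]
    have hc : Continuous fun θ => Complex.exp (Complex.I * ((d θ / √n : ℝ) : ℂ)) /
        (1 - Complex.I * ((e θ / √n : ℝ) : ℂ)) :=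
      Continuous.div (by fun_prop) (by fun_prop) fun θ => aux_ne _
    rw [intervalIntegral.integral_sub, intervalIntegral.integral_const_mul,
      intervalIntegral.integral_const_mul, hlin, intervalIntegral.integral_sub,
      intervalIntegral.integral_const]
    · rw [sub_zero, Complex.real_smul, Complex.ofReal_inv, mul_one, mul_zero, sub_zero]
      field_simp
    · exact hc.intervalIntegrable _ _
    · exact intervalIntegrable_const
    · exact (continuous_const.mul (hc.sub continuous_const)).intervalIntegrable _ _
    · exact Continuous.intervalIntegrable (by fun_prop) _ _
  have hlim : Tendsto (fun n : ℕ => (n : ℂ) * (φ μ t C₁ C₂ n α β - 1)) atTop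
      (nhds ((-(α ^ 2 / 2 * (t ^ 2 / μ ^ 2 + C₁ * t / μ + C₁ ^ 2 / 2)
          + β ^ 2 / 2 * (t ^ 2 / μ ^ 2 + C₂ * t / μ + C₂ ^ 2 / 2)) : ℝ) : ℂ)) := by
    have h := hint.const_mul (((2 * π : ℝ) : ℂ)⁻¹)
    rw [hval, inv_mul_cancel_left₀ hπ] at h
    refine h.congr' ?_
    filter_upwards [eventually_gt_atTop 0] with n hn
    exact (hmul n hn).symm
  have := Complex.tendsto_one_add_pow_exp_of_tendsto hlim
  simpa using this
end
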